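/- Let V = W(m,n) and A = R_m ⊗ Λ. Every simple weight AV-module of finite rank is a tensor module. Such modules are parametrized by finite-dimensional simple gl(m,n)-modules V' and their supports λ + ℤ^m: the tensor module is A ⊗ V' with the W(m,n)-action (t^s f d_j)(t^r g ⊗ v) = (r_j+λ_j) t^{r+s} f g ⊗ v + Σ_{i=1}^m s_i t^{r+s} f ⊗ ρ(e_{ij}) g·v + Σ_{α=1}^n t^{r+s} (f)∂*_α ⊗ ρ(e_{αj}) g·v, and (t^s f ∂_β)(t^r g ⊗ v) = t^{r+s} f (∂g/∂ξ_β) ⊗ v + Σ_{i=1}^m s_i t^{r+s} f ⊗ ρ(e_{iβ}) g·v + Σ_{α=1}^n t^{r+s} (f)∂*_α ⊗ ρ(e_{αβ}) g·v, for f,g ∈ Λ, r,s ∈ ℤ^m. -/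

import Mathlib

open scoped BigOperators

namespace WSuper

noncomputable section

/-- Exponents of the Laurent (even) variables `t_1, …, t_m`. -/
abbrev LExp (m : ℕ) := Fin m → ℤ
/-- Exponents of the Grassmann (odd) variables `ξ_1, …, ξ_n`. -/
abbrev GExp (n : ℕ) := Fin n → Bool

variable {m n : ℕ}

/-- Degree of a Grassmann monomial `ξ^s`. -/
def gdeg (s : GExp n) : ℕ := (Finset.univ.filter fun a => s a = true).card

/-- Number of inversions between `ξ^s` and `ξ^q`. -/
def invCount (s q : GExp n) : ℕ :=
  ((Finset.univ ×ˢ Finset.univ).filter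
    fun p : Fin n × Fin n => s p.1 = true ∧ q p.2 = true ∧ p.2 < p.1).card

/-- The scalar `c` with `ξ^s · ξ^q = c · ξ^(s xor q)` in the exterior algebra. -/
def mulSgn (s q : GExp n) : ℂ :=
  if ∃ a, s a = true ∧ q a = true then 0 else (-1 : ℂ) ^ invCount s q

/-- Exponent of the product of two (disjoint) Grassmann monomials. -/
def xorE (s q : GExp n) : GExp n := fun a => Bool.xor (s a) (q a)

/-- The scalar `c` with `∂_a (ξ^s) = c ξ^(s \ a)`. -/
def derC (a : Fin n) (s : GExp n) : ℂ :=
  if s a = true then (-1 : ℂ) ^ (Finset.univ.filter fun x => s x = true ∧ x < a).card else 0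

/-- The exponent of `∂_a (ξ^s)`. -/
def derE (a : Fin n) (s : GExp n) : GExp n := Function.update s a false

/-- Directions: `d_i = t_i ∂/∂t_i`, `∂_α = ∂/∂ξ_α`, and (when `b = true`) the extra
even direction `d_0` of `W(m,n) ⋉ A d_0`. -/
inductive Dir (m n : ℕ) : Bool → Type where
  | di {b : Bool} (i : Fin m) : Dir m n b
  | pa {b : Bool} (a : Fin n) : Dir m n b
  | d0 : Dir m n true

/-- The basis `t^r ξ^s D` of `W(m,n)` (for `b = false`) resp. of `W(m,n) ⋉ A d_0`
(for `b = true`). -/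
abbrev WBasis (m n : ℕ) (b : Bool) := LExp m × GExp n × Dir m n b

/-- The Lie superalgebra `W(m,n)` (`b = false`) resp. `W(m,n) ⋉ A d_0` (`b = true`),
as the free complex vector space on its standard basis. -/
abbrev W (m n : ℕ) (b : Bool) := WBasis m n b →₀ ℂ

def sng {b : Bool} (x : WBasis m n b) : W m n b := Finsupp.single x 1

/-- Parity (0 = even, 1 = odd) of a basis element. -/
def par {b : Bool} : WBasis m n b → ℕ
  | ⟨_, s, .di _⟩ => gdeg s % 2
  | ⟨_, s, .pa _⟩ => (gdeg s + 1) % 2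
  | ⟨_, s, .d0⟩ => gdeg s % 2

/-- The super Lie bracket of `W(m,n)` (resp. `W(m,n) ⋉ A d_0`) on basis elements. -/
def brB {b : Bool} : WBasis m n b → WBasis m n b → W m n b
  | ⟨r, s, .di i⟩, ⟨p, q, .di j⟩ =>
      ((p i : ℂ) * mulSgn s q) • sng ⟨r + p, xorE s q, .di j⟩
        - ((r j : ℂ) * mulSgn s q) • sng ⟨r + p, xorE s q, .di i⟩
  | ⟨r, s, .di i⟩, ⟨p, q, .pa β⟩ =>
      ((p i : ℂ) * mulSgn s q) • sng ⟨r + p, xorE s q, .pa β⟩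
        - ((-1 : ℂ) ^ (gdeg s * (gdeg q + 1)) * derC β s * mulSgn q (derE β s)) •
            sng ⟨r + p, xorE q (derE β s), .di i⟩
  | ⟨r, s, .pa α⟩, ⟨p, q, .di j⟩ =>
      (derC α q * mulSgn s (derE α q)) • sng ⟨r + p, xorE s (derE α q), .di j⟩
        - ((-1 : ℂ) ^ ((gdeg s + 1) * gdeg q) * (r j : ℂ) * mulSgn q s) •
            sng ⟨r + p, xorE q s, .pa α⟩
  | ⟨r, s, .pa α⟩, ⟨p, q, .pa β⟩ =>
      (derC α q * mulSgn s (derE α q)) • sng ⟨r + p, xorE s (derE α q), .pa β⟩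
        - ((-1 : ℂ) ^ ((gdeg s + 1) * (gdeg q + 1)) * derC β s * mulSgn q (derE β s)) •
            sng ⟨r + p, xorE q (derE β s), .pa α⟩
  | ⟨r, s, .di i⟩, ⟨p, q, .d0⟩ =>
      ((p i : ℂ) * mulSgn s q) • sng ⟨r + p, xorE s q, .d0⟩
  | ⟨r, s, .pa α⟩, ⟨p, q, .d0⟩ =>
      (derC α q * mulSgn s (derE α q)) • sng ⟨r + p, xorE s (derE α q), .d0⟩
  | ⟨r, s, .d0⟩, ⟨p, q, .di j⟩ =>
      (-(r j : ℂ) * mulSgn s q) • sng ⟨r + p, xorE s q, .d0⟩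
  | ⟨r, s, .d0⟩, ⟨p, q, .pa β⟩ =>
      (-(-1 : ℂ) ^ (gdeg s * (gdeg q + 1)) * derC β s * mulSgn q (derE β s)) •
          sng ⟨r + p, xorE q (derE β s), .d0⟩
  | ⟨_, _, .d0⟩, ⟨_, _, .d0⟩ => 0

/-- A module over the Lie superalgebra `W(m,n)` (resp. `W(m,n) ⋉ A d_0`):
a complex vector space with a linear action satisfying the super commutator rule. -/
structure WRep (m n : ℕ) (b : Bool) where
  M : Type
  [addgrp : AddCommGroup M]
  [mods : Module ℂ M]
  act : W m n b →ₗ[ℂ] M →ₗ[ℂ] M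
  super : ∀ x y : WBasis m n b,
    act (brB x y)
      = act (sng x) ∘ₗ act (sng y)
        - ((-1 : ℂ) ^ (par x * par y)) • (act (sng y) ∘ₗ act (sng x))

attribute [instance] WRep.addgrp WRep.mods

/-- A raw action of (the basis of) `W(m,n)` resp. `W(m,n) ⋉ A d_0` on a vector space. -/
abbrev GAct (m n : ℕ) (b : Bool) (M : Type) [AddCommGroup M] [Module ℂ M] :=
  WBasis m n b → M →ₗ[ℂ] M

/-- Index set for the Cartan subalgebra `h'`: the elements `d_1, …, d_m`,
together with `d_0` when `b = true`. -/
abbrev HIdx (m : ℕ) (b : Bool) := Fin m ⊕ Fin (cond b 1 0)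

def hB (m n : ℕ) (b : Bool) : HIdx m b → WBasis m n b :=
  fun h => match b, h with
    | _, .inl i => ⟨0, fun _ => false, .di i⟩
    | true, .inr _ => ⟨0, fun _ => false, .d0⟩
    | false, .inr j => j.elim0

/-- The basis element `ξ_a ∂_a` of the odd Cartan subalgebra `h''`. -/
def hppB (m n : ℕ) (b : Bool) (a : Fin n) : WBasis m n b :=
  ⟨0, fun x => decide (x = a), .pa a⟩

section Predicates

variable {M : Type} [AddCommGroup M] [Module ℂ M] {b : Bool}

/-- Weight space with respect to the even Cartan subalgebra `h'`. -/
def wtG (F : GAct m n b M) (lam : HIdx m b → ℂ) : Submodule ℂ M :=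
  ⨅ h, LinearMap.ker (F (hB m n b h) - lam h • (LinearMap.id : M →ₗ[ℂ] M))

/-- Weight space with respect to the full Cartan subalgebra `h = h' ⊕ h''`. -/
def wtFullG (F : GAct m n b M) (lam : HIdx m b → ℂ) (mu : Fin n → ℂ) : Submodule ℂ M :=
  wtG F lam ⊓
    ⨅ a, LinearMap.ker (F (hppB m n b a) - mu a • (LinearMap.id : M →ₗ[ℂ] M))

/-- Strong Harish-Chandra module: weight decomposition with respect to `h'`
with finite-dimensional weight spaces. -/
def IsStrongHCG (F : GAct m n b M) : Prop :=
  (⨆ lam, wtG F lam) = ⊤ ∧ ∀ lam, FiniteDimensional ℂ (wtG F lam)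

/-- Harish-Chandra module: weight decomposition with respect to `h`
with finite-dimensional weight spaces. -/
def IsHCG (F : GAct m n b M) : Prop :=
  (⨆ lam, ⨆ mu, wtFullG F lam mu) = ⊤ ∧
    ∀ lam mu, FiniteDimensional ℂ (wtFullG F lam mu)

/-- Strongly cuspidal: strong Harish-Chandra with uniformly bounded multiplicities. -/
def IsStronglyCuspidalG (F : GAct m n b M) : Prop :=
  IsStrongHCG F ∧ ∃ C : ℕ, ∀ lam, Module.finrank ℂ (wtG F lam) ≤ C

/-- Cuspidal: Harish-Chandra with uniformly bounded weight multiplicities. -/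
def IsCuspidalG (F : GAct m n b M) : Prop :=
  IsHCG F ∧ ∃ C : ℕ, ∀ lam mu, Module.finrank ℂ (wtFullG F lam mu) ≤ C

/-- The action of the odd Cartan subalgebra `h''` is diagonalizable. -/
def DiagHppG (F : GAct m n b M) : Prop :=
  (⨆ mu : Fin n → ℂ,
    ⨅ a, LinearMap.ker (F (hppB m n b a) - mu a • (LinearMap.id : M →ₗ[ℂ] M))) = ⊤

def InvariantG (F : GAct m n b M) (N : Submodule ℂ M) : Prop :=
  ∀ x : WBasis m n b, ∀ v ∈ N, F x v ∈ N

/-- Simplicity of a module, phrased via invariant subspaces. -/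
def IsSimpleG (F : GAct m n b M) : Prop :=
  (∃ v : M, v ≠ 0) ∧ ∀ N : Submodule ℂ M, InvariantG F N → N = ⊥ ∨ N = ⊤

end Predicates

/-- The action of basis elements attached to a representation. -/
def WRep.g {b : Bool} (ρ : WRep m n b) : GAct m n b ρ.M := fun x => ρ.act (sng x)

end

end WSuper

namespace WSuper

noncomputable section

variable {m n : ℕ}

/-- Basis monomials `t^r ξ^s` of the supercommutative superalgebra `A = R_m ⊗ Λ`. -/
abbrev ABasis (m n : ℕ) := LExp m × GExp n

/-- The supercommutative superalgebra `A = R_m ⊗ Λ` as the free complex vector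
space on its monomial basis. -/
abbrev AAlg (m n : ℕ) := ABasis m n →₀ ℂ

def asng (x : ABasis m n) : AAlg m n := Finsupp.single x 1

def aone (m n : ℕ) : AAlg m n := asng (0, fun _ => false)

/-- Product of two monomials of `A`. -/
def amulB (x y : ABasis m n) : AAlg m n :=
  mulSgn x.2 y.2 • asng (x.1 + y.1, xorE x.2 y.2)

/-- Parity of a monomial of `A`. -/
def apar (x : ABasis m n) : ℕ := gdeg x.2 % 2

/-- The action of a basis element of `W(m,n)` (resp. `W(m,n) ⋉ A d_0`) on a
monomial of `A` by superderivations (`d_0` acts by zero on `A`). -/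
def wOnA {b : Bool} : WBasis m n b → ABasis m n → AAlg m n
  | ⟨r, s, .di i⟩, ⟨p, q⟩ => ((p i : ℂ) * mulSgn s q) • asng (r + p, xorE s q)
  | ⟨r, s, .pa α⟩, ⟨p, q⟩ =>
      (derC α q * mulSgn s (derE α q)) • asng (r + p, xorE s (derE α q))
  | ⟨_, _, .d0⟩, _ => 0

/-- An `AV`-module: compatible actions of the superalgebra `A` and of the Lie
superalgebra `V = W(m,n)` (resp. `W(m,n) ⋉ A d_0`), satisfying the Leibniz rule. -/
structure AVRep (m n : ℕ) (b : Bool) extends WRep m n b where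
  aact : AAlg m n →ₗ[ℂ] M →ₗ[ℂ] M
  aact_one : aact (aone m n) = LinearMap.id
  aact_mul : ∀ x y : ABasis m n, aact (amulB x y) = aact (asng x) ∘ₗ aact (asng y)
  leibniz : ∀ (x : WBasis m n b) (f : ABasis m n),
    act (sng x) ∘ₗ aact (asng f)
      = aact (wOnA x f)
        + ((-1 : ℂ) ^ (par x * apar f)) • (aact (asng f) ∘ₗ act (sng x))

/-- `M` is finitely generated as an `A`-module. -/
def IsFiniteRank {b : Bool} (ρ : AVRep m n b) : Prop :=
  ∃ S : Finset ρ.M,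
    Submodule.span ℂ {v : ρ.M | ∃ f : ABasis m n, ∃ s ∈ S, v = ρ.aact (asng f) s} = ⊤

/-- A subspace invariant under both the `A`-action and the `V`-action. -/
def AVInvariant {b : Bool} (ρ : AVRep m n b) (N : Submodule ℂ ρ.M) : Prop :=
  InvariantG ρ.g N ∧ ∀ f : ABasis m n, ∀ v ∈ N, ρ.aact (asng f) v ∈ N

/-- Irreducibility as an `AV`-module. -/
def AVIsSimple {b : Bool} (ρ : AVRep m n b) : Prop :=
  (∃ v : ρ.M, v ≠ 0) ∧ ∀ N : Submodule ℂ ρ.M, AVInvariant ρ N → N = ⊥ ∨ N = ⊤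

/-- A weight module: weight decomposition with respect to `h'`. -/
def IsWeightG {M : Type} [AddCommGroup M] [Module ℂ M] {b : Bool}
    (F : GAct m n b M) : Prop :=
  (⨆ lam, wtG F lam) = ⊤

end

end WSuper

namespace WSuper

noncomputable section

variable {m n : ℕ}

/-- Index set for the standard basis `e_{xy}` of `gl(m,n)`. -/
abbrev GlIdx (m n : ℕ) := Fin m ⊕ Fin n

/-- Parity of an index of `gl(m,n)`. -/
def gpar : GlIdx m n → ℕ
  | .inl _ => 0
  | .inr _ => 1

/-- A module over the Lie superalgebra `gl(m,n)`, given by the action of the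
standard basis elements `e_{xy}` subject to the super commutator relations. -/
structure GlRep (m n : ℕ) where
  V : Type
  [addgrp : AddCommGroup V]
  [mods : Module ℂ V]
  ρ : GlIdx m n → GlIdx m n → Module.End ℂ V
  rel : ∀ x y z w : GlIdx m n,
    ρ x y * ρ z w
        - ((-1 : ℂ) ^ ((gpar x + gpar y) * (gpar z + gpar w))) • (ρ z w * ρ x y)
      = (if y = z then ρ x w else 0)
        - ((-1 : ℂ) ^ ((gpar x + gpar y) * (gpar z + gpar w))) •
            (if w = x then ρ z y else 0)

attribute [instance] GlRep.addgrp GlRep.mods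

/-- Irreducibility of a `gl(m,n)`-module. -/
def GlRep.IsSimple (σ : GlRep m n) : Prop :=
  (∃ v : σ.V, v ≠ 0) ∧
    ∀ N : Submodule ℂ σ.V, (∀ x y, ∀ v ∈ N, σ.ρ x y v ∈ N) → N = ⊥ ∨ N = ⊤

/-- The carrier `A ⊗ V` of a tensor module. -/
abbrev TModule (σ : GlRep m n) := ABasis m n →₀ σ.V

/-- The action of `W(m,n)` (resp. `W(m,n) ⋉ A d_0`, where `f d_0` acts as
multiplication by `λ_0 f`) on the tensor module `T(V, λ) = A ⊗ V`:
`(t^s f d_j)(t^r g ⊗ v) = (r_j + λ_j) t^{r+s} f g ⊗ v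
  + Σ_i s_i t^{r+s} f ⊗ ρ(e_{ij}) g·v + Σ_α t^{r+s} (f)∂*_α ⊗ ρ(e_{αj}) g·v`,
`(t^s f ∂_β)(t^r g ⊗ v) = t^{r+s} f (∂g/∂ξ_β) ⊗ v
  + Σ_i s_i t^{r+s} f ⊗ ρ(e_{iβ}) g·v + Σ_α t^{r+s} (f)∂*_α ⊗ ρ(e_{αβ}) g·v`,
with `(f)∂*_α = (−1)^{|f|+1} ∂_α(f)` and the usual Koszul signs for applying an
operator `a ⊗ ρ(e)` with `e` odd to `g ⊗ v`. -/
def tmAct (σ : GlRep m n) (lam : Fin m → ℂ) (lam0 : ℂ) {b : Bool} :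
    WBasis m n b → TModule σ → TModule σ
  | ⟨s, f, .di j⟩, u => u.sum fun rc v =>
      ((((rc.1 j : ℂ) + lam j) * mulSgn f rc.2) •
          Finsupp.single (rc.1 + s, xorE f rc.2) v)
      + (∑ i : Fin m, ((s i : ℂ) * mulSgn f rc.2) •
          Finsupp.single (rc.1 + s, xorE f rc.2) (σ.ρ (.inl i) (.inl j) v))
      + (∑ α : Fin n,
          ((-1 : ℂ) ^ gdeg rc.2 * ((-1 : ℂ) ^ (gdeg f + 1) * derC α f) *
              mulSgn (derE α f) rc.2) •
            Finsupp.single (rc.1 + s, xorE (derE α f) rc.2) (σ.ρ (.inr α) (.inl j) v))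
  | ⟨s, f, .pa β⟩, u => u.sum fun rc v =>
      ((derC β rc.2 * mulSgn f (derE β rc.2)) •
          Finsupp.single (rc.1 + s, xorE f (derE β rc.2)) v)
      + (∑ i : Fin m, ((-1 : ℂ) ^ gdeg rc.2 * (s i : ℂ) * mulSgn f rc.2) •
          Finsupp.single (rc.1 + s, xorE f rc.2) (σ.ρ (.inl i) (.inr β) v))
      + (∑ α : Fin n,
          (((-1 : ℂ) ^ (gdeg f + 1) * derC α f) * mulSgn (derE α f) rc.2) •
            Finsupp.single (rc.1 + s, xorE (derE α f) rc.2) (σ.ρ (.inr α) (.inr β) v))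
  | ⟨s, f, .d0⟩, u => u.sum fun rc v =>
      (lam0 * mulSgn f rc.2) • Finsupp.single (rc.1 + s, xorE f rc.2) v

/-- The action of `A` on the tensor module `A ⊗ V` by multiplication on the
left tensor factor. -/
def tmA {σ : GlRep m n} (x : ABasis m n) (u : TModule σ) : TModule σ :=
  u.sum fun rc v => mulSgn x.2 rc.2 • Finsupp.single (x.1 + rc.1, xorE x.2 rc.2) v

end

end WSuper

namespace WSuper

noncomputable section

section Signs

variable {n : ℕ}

/-- The empty Grassmann exponent. -/
abbrev gzero (n : ℕ) : GExp n := fun _ => false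

/-- The exponent of the generator `ξ_a`. -/
abbrev gsingle (a : Fin n) : GExp n := fun x => decide (x = a)

/-- The integer `0` or `1` attached to a Boolean exponent. -/
def bit (b : Bool) : ℕ := if b = true then 1 else 0

theorem gdeg_eq_sum (s : GExp n) : gdeg s = ∑ a, bit (s a) := by
  rw [gdeg, Finset.card_filter]; rfl

theorem invCount_eq_sum (s q : GExp n) :
    invCount s q = ∑ a, ∑ b, if b < a then bit (s a) * bit (q b) else 0 := by
  rw [invCount, Finset.card_filter, Finset.sum_product]
  refine Finset.sum_congr rfl fun a _ => Finset.sum_congr rfl fun b _ => ?_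
  cases hs : s a <;> cases hq : q b <;> by_cases h : b < a <;> simp [bit, h]

/-- The bicharacter underlying the multiplication of Grassmann monomials. -/
def gsgn (s q : GExp n) : ℂ := (-1 : ℂ) ^ invCount s q

theorem gsgn_eq_prod (s q : GExp n) :
    gsgn s q = ∏ a, ∏ b, if b < a then (-1 : ℂ) ^ (bit (s a) * bit (q b)) else 1 := by
  rw [gsgn, invCount_eq_sum, ← Finset.prod_pow_eq_pow_sum]
  refine Finset.prod_congr rfl fun a _ => ?_
  rw [← Finset.prod_pow_eq_pow_sum]
  refine Finset.prod_congr rfl fun b _ => ?_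
  split_ifs <;> simp

theorem gsgn_xorE_right (s q q' : GExp n) : gsgn s (xorE q q') = gsgn s q * gsgn s q' := by
  simp only [gsgn_eq_prod, ← Finset.prod_mul_distrib]
  refine Finset.prod_congr rfl fun a _ => Finset.prod_congr rfl fun b _ => ?_
  cases hs : q b <;> cases hs' : q' b <;> by_cases h : b < a <;> cases hq : s a <;>
    simp [xorE, bit, h, hs, hs']

theorem gsgn_mul_self (s q : GExp n) : gsgn s q * gsgn s q = 1 := by
  rw [gsgn, ← pow_add, ← two_mul]; simp

theorem gsgn_ne_zero (s q : GExp n) : gsgn s q ≠ 0 := by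
  simp [gsgn]

theorem gsgn_comm (s q : GExp n) (h : ∀ a, ¬ (s a = true ∧ q a = true)) :
    gsgn s q * gsgn q s = (-1 : ℂ) ^ (gdeg s * gdeg q) := by
  rw [gsgn, gsgn, ← pow_add]
  congr 1
  rw [invCount_eq_sum, invCount_eq_sum, gdeg_eq_sum, gdeg_eq_sum, Finset.sum_mul_sum,
    Finset.sum_comm (f := fun a b => if b < a then bit (q a) * bit (s b) else 0),
    ← Finset.sum_add_distrib]
  refine Finset.sum_congr rfl fun a _ => ?_
  rw [← Finset.sum_add_distrib]
  refine Finset.sum_congr rfl fun b _ => ?_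
  rcases lt_trichotomy a b with hab | rfl | hab
  · simp [hab, hab.not_gt, mul_comm]
  · have := h a
    cases hs : s a <;> cases hq : q a <;> simp_all [bit]
  · simp [hab, hab.not_gt]

theorem mulSgn_of_disjoint {s q : GExp n} (h : ∀ a, ¬ (s a = true ∧ q a = true)) :
    mulSgn s q = gsgn s q := by
  rw [mulSgn, if_neg (by simpa using h), gsgn]

theorem mulSgn_of_not_disjoint {s q : GExp n} {a : Fin n} (h : s a = true) (h' : q a = true) :
    mulSgn s q = 0 := by
  rw [mulSgn, if_pos ⟨a, h, h'⟩]

theorem mulSgn_comm (s q : GExp n) :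
    mulSgn s q = (-1 : ℂ) ^ (gdeg s * gdeg q) * mulSgn q s := by
  by_cases h : ∀ a, ¬ (s a = true ∧ q a = true)
  · rw [mulSgn_of_disjoint h, mulSgn_of_disjoint fun a ha => h a ha.symm, ← gsgn_comm s q h,
      mul_assoc, gsgn_mul_self, mul_one]
  · push Not at h
    obtain ⟨a, h1, h2⟩ := h
    rw [mulSgn_of_not_disjoint h1 h2, mulSgn_of_not_disjoint h2 h1, mul_zero]

theorem xorE_comm (s q : GExp n) : xorE s q = xorE q s := by
  funext a; simp [xorE, Bool.xor_comm]

@[simp] theorem gzero_xorE (s : GExp n) : xorE (gzero n) s = s := by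
  funext a; simp [xorE]

@[simp] theorem xorE_gzero (s : GExp n) : xorE s (gzero n) = s := by
  funext a; simp [xorE]

theorem gdeg_gzero : gdeg (gzero n) = 0 := by simp [gdeg]

theorem gdeg_eq_zero {s : GExp n} : gdeg s = 0 ↔ s = gzero n := by
  simp [gdeg, Finset.filter_eq_empty_iff, funext_iff]

theorem gdeg_gsingle (a : Fin n) : gdeg (gsingle a) = 1 := by
  rw [gdeg, Finset.card_eq_one]; exact ⟨a, by ext; simp⟩

theorem gdeg_eq_one {s : GExp n} (h : gdeg s = 1) : ∃ a, s = gsingle a := by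
  obtain ⟨a, ha⟩ := Finset.card_eq_one.mp h
  refine ⟨a, funext fun x => ?_⟩
  have := congrArg (x ∈ ·) ha
  simp only [Finset.mem_filter, Finset.mem_univ, true_and, Finset.mem_singleton, eq_iff_iff] at this
  by_cases hx : x = a <;> simp_all

theorem invCount_gzero_left (q : GExp n) : invCount (gzero n) q = 0 := by
  simp [invCount_eq_sum, bit]

theorem invCount_gzero_right (q : GExp n) : invCount q (gzero n) = 0 := by
  simp [invCount_eq_sum, bit]

@[simp] theorem mulSgn_gzero_left (q : GExp n) : mulSgn (gzero n) q = 1 := by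
  rw [mulSgn_of_disjoint (by simp), gsgn, invCount_gzero_left, pow_zero]

@[simp] theorem mulSgn_gzero_right (q : GExp n) : mulSgn q (gzero n) = 1 := by
  rw [mulSgn_of_disjoint (by simp), gsgn, invCount_gzero_right, pow_zero]

@[simp] theorem derC_gzero (a : Fin n) : derC a (gzero n) = 0 := by simp [derC]

theorem derC_of_false {a : Fin n} {s : GExp n} (h : s a = false) : derC a s = 0 := by
  simp [derC, h]

theorem invCount_gsingle_left (a : Fin n) (s : GExp n) :
    invCount (gsingle a) s = (Finset.univ.filter fun x => s x = true ∧ x < a).card := by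
  rw [invCount_eq_sum, Finset.sum_eq_single a]
  · rw [Finset.card_filter]
    refine Finset.sum_congr rfl fun b _ => ?_
    cases s b <;> by_cases h : b < a <;> simp [bit, h]
  · intro b _ hb
    simp [bit, hb]
  · simp

theorem derC_of_true {a : Fin n} {s : GExp n} (h : s a = true) : derC a s = gsgn (gsingle a) s := by
  rw [derC, if_pos h, gsgn, invCount_gsingle_left]

theorem derC_ne_zero {a : Fin n} {s : GExp n} (h : s a = true) : derC a s ≠ 0 := by
  rw [derC_of_true h]; exact gsgn_ne_zero _ _

theorem derE_eq_xorE {a : Fin n} {s : GExp n} (h : s a = true) : derE a s = xorE (gsingle a) s := by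
  funext x
  by_cases hx : x = a
  · subst hx; simp [derE, xorE, h]
  · simp [derE, xorE, gsingle, hx]

theorem derE_apply_self (a : Fin n) (s : GExp n) : derE a s a = false := by simp [derE]

theorem derE_apply_of_ne {a b : Fin n} (h : b ≠ a) (s : GExp n) : derE a s b = s b := by
  simp [derE, h]

theorem xorE_gsingle_derE {a : Fin n} {s : GExp n} (h : s a = true) :
    xorE (gsingle a) (derE a s) = s := by
  funext x
  by_cases hx : x = a
  · subst hx; simp [derE, xorE, h]
  · simp [derE, xorE, gsingle, hx]

theorem derE_gsingle (a : Fin n) : derE a (gsingle a) = gzero n := by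
  funext x
  by_cases hx : x = a <;> simp [derE, hx]

theorem gsgn_gsingle_self (a : Fin n) : gsgn (gsingle a) (gsingle a) = 1 := by
  rw [gsgn, invCount_gsingle_left, Finset.card_eq_zero.mpr, pow_zero]
  ext x
  simpa using fun h : x = a => h.ge

@[simp] theorem derC_gsingle_self (a : Fin n) : derC a (gsingle a) = 1 := by
  rw [derC_of_true (by simp), gsgn_gsingle_self]

theorem derC_gsingle_of_ne {a b : Fin n} (h : a ≠ b) : derC a (gsingle b) = 0 :=
  derC_of_false (by simp [h])

theorem derC_mul_mulSgn {a : Fin n} {s : GExp n} (h : s a = true) :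
    derC a s * mulSgn (gsingle a) (derE a s) = 1 := by
  have hd : ∀ x, ¬ (gsingle a x = true ∧ derE a s x = true) := by
    intro x ⟨h1, h2⟩
    have : x = a := by simpa using h1
    subst this
    simp [derE] at h2
  rw [mulSgn_of_disjoint hd, derC_of_true h, derE_eq_xorE h, gsgn_xorE_right, gsgn_gsingle_self,
    one_mul, gsgn_mul_self]

theorem gdeg_derE {a : Fin n} {s : GExp n} (h : s a = true) : gdeg (derE a s) + 1 = gdeg s := by
  have : (Finset.univ.filter fun x => derE a s x = true)
      = (Finset.univ.filter fun x => s x = true).erase a := by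
    ext x
    by_cases hx : x = a <;>
      simp only [Finset.mem_filter, Finset.mem_univ, Finset.mem_erase] <;> simp [derE, hx]
  rw [gdeg, gdeg, this, Finset.card_erase_of_mem (by simp [h])]
  have : 0 < (Finset.univ.filter fun x => s x = true).card := Finset.card_pos.mpr ⟨a, by simp [h]⟩
  omega

theorem derE_comm (a b : Fin n) (s : GExp n) : derE a (derE b s) = derE b (derE a s) := by
  funext x
  by_cases ha : x = a <;> by_cases hb : x = b <;> simp [derE, Function.update_apply, ha, hb]

theorem gsgn_gsingle_swap {a b : Fin n} (h : a ≠ b) :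
    gsgn (gsingle a) (gsingle b) = - gsgn (gsingle b) (gsingle a) := by
  have := gsgn_comm (gsingle a) (gsingle b) (by
    intro x; simp only [decide_eq_true_eq]; rintro ⟨rfl, h'⟩; exact h h')
  rw [gdeg_gsingle, gdeg_gsingle, mul_one, pow_one] at this
  calc gsgn (gsingle a) (gsingle b)
      = gsgn (gsingle a) (gsingle b) * (gsgn (gsingle b) (gsingle a) *
          gsgn (gsingle b) (gsingle a)) := by rw [gsgn_mul_self, mul_one]
    _ = _ := by rw [← mul_assoc, this, neg_one_mul]

theorem derC_anticomm (a b : Fin n) (s : GExp n) :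
    derC a s * derC b (derE a s) = - (derC b s * derC a (derE b s)) := by
  by_cases hab : a = b
  · subst hab
    rw [derC_of_false (derE_apply_self a s)]; simp
  cases ha : s a
  · rw [derC_of_false ha, derC_of_false (a := a) (by rw [derE_apply_of_ne hab, ha])]; simp
  cases hb : s b
  · rw [derC_of_false hb, derC_of_false (a := b) (by rw [derE_apply_of_ne (Ne.symm hab), hb])]
    simp
  rw [derC_of_true ha, derC_of_true hb,
    derC_of_true (a := b) (by rw [derE_apply_of_ne (Ne.symm hab), hb]),
    derC_of_true (a := a) (by rw [derE_apply_of_ne hab, ha]), derE_eq_xorE ha, derE_eq_xorE hb,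
    gsgn_xorE_right, gsgn_xorE_right, gsgn_gsingle_swap hab]
  ring

theorem neg_one_pow_mod_two (k : ℕ) : (-1 : ℂ) ^ (k % 2) = (-1) ^ k :=
  (neg_one_pow_eq_pow_mod_two k).symm

theorem neg_one_pow_mod_two_mul (k l : ℕ) : (-1 : ℂ) ^ (k % 2 * l) = (-1) ^ (k * l) := by
  rw [pow_mul, neg_one_pow_mod_two, ← pow_mul]

theorem neg_one_pow_mul_mod_two (k l : ℕ) : (-1 : ℂ) ^ (l * (k % 2)) = (-1) ^ (l * k) := by
  rw [mul_comm, neg_one_pow_mod_two_mul, mul_comm]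

end Signs

section Differences

variable {m : ℕ} {L : Type*} [AddCommGroup L] [Module ℂ L]

/-- Translation by `r` in the direction `i`. -/
def shiftOp (L : Type*) [AddCommGroup L] [Module ℂ L] (i : Fin m) (r : ℤ) :
    Module.End ℂ (LExp m → L) :=
  LinearMap.funLeft ℂ L fun s => s + Pi.single i r

/-- Forward difference in the direction `i`. -/
def diffOp (L : Type*) [AddCommGroup L] [Module ℂ L] (i : Fin m) : Module.End ℂ (LExp m → L) :=
  shiftOp L i 1 - 1

/-- Multiplication by the `i`-th coordinate. -/
def coordOp (L : Type*) [AddCommGroup L] [Module ℂ L] (i : Fin m) :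
    Module.End ℂ (LExp m → L) where
  toFun f s := (s i : ℂ) • f s
  map_add' f g := by ext s; simp
  map_smul' c f := by ext s; simp [smul_comm c]

@[simp] theorem shiftOp_apply (i : Fin m) (r : ℤ) (f : LExp m → L) (s : LExp m) :
    shiftOp L i r f s = f (s + Pi.single i r) := rfl

@[simp] theorem diffOp_apply (i : Fin m) (f : LExp m → L) (s : LExp m) :
    diffOp L i f s = f (s + Pi.single i 1) - f s := rfl

@[simp] theorem coordOp_apply (i : Fin m) (f : LExp m → L) (s : LExp m) :
    coordOp L i f s = (s i : ℂ) • f s := rfl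

theorem shiftOp_zero (i : Fin m) : shiftOp L i 0 = 1 := by
  ext f s; simp

theorem commute_shiftOp (i j : Fin m) (r p : ℤ) : Commute (shiftOp L i r) (shiftOp L j p) := by
  refine LinearMap.ext fun f => funext fun s => ?_
  simp [add_right_comm]

theorem commute_diffOp_shiftOp (i j : Fin m) (p : ℤ) : Commute (diffOp L i) (shiftOp L j p) :=
  (commute_shiftOp i j 1 p).sub_left (Commute.one_left _)

theorem commute_diffOp (i j : Fin m) : Commute (diffOp L i) (diffOp L j) :=
  (commute_diffOp_shiftOp i j 1).sub_right (Commute.one_right _)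

theorem diffOp_mul_coordOp (i : Fin m) :
    diffOp L i * coordOp L i = coordOp L i * diffOp L i + shiftOp L i 1 := by
  refine LinearMap.ext fun f => funext fun s => ?_
  simp only [Module.End.mul_apply, LinearMap.add_apply, Pi.add_apply, diffOp_apply, coordOp_apply,
    shiftOp_apply, Pi.single_eq_same]
  push_cast
  module

theorem diffOp_mul_coordOp_of_ne {i j : Fin m} (h : i ≠ j) :
    diffOp L j * coordOp L i = coordOp L i * diffOp L j := by
  refine LinearMap.ext fun f => funext fun s => ?_
  simp [Module.End.mul_apply, h, smul_sub]

theorem diffOp_pow_mul_coordOp (i : Fin m) (K : ℕ) :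
    diffOp L i ^ (K + 1) * coordOp L i
      = coordOp L i * diffOp L i ^ (K + 1) + ((K : ℂ) + 1) • (shiftOp L i 1 * diffOp L i ^ K) := by
  induction K with
  | zero => simp [diffOp_mul_coordOp]
  | succ K ih =>
    rw [pow_succ', mul_assoc, ih, mul_add, ← mul_assoc, diffOp_mul_coordOp, mul_smul_comm,
      ← mul_assoc (diffOp L i), (commute_diffOp_shiftOp i i 1).eq, mul_assoc (shiftOp L i 1),
      ← pow_succ', add_mul, mul_assoc, ← pow_succ']
    push_cast
    module

theorem map_diffOp_pow {L' : Type*} [AddCommGroup L'] [Module ℂ L'] (φ : L →ₗ[ℂ] L') (i : Fin m)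
    (k : ℕ) (f : LExp m → L) (s : LExp m) :
    φ ((diffOp L i ^ k) f s) = (diffOp L' i ^ k) (fun p => φ (f p)) s := by
  induction k generalizing f with
  | zero => simp
  | succ k ih =>
    rw [pow_succ, pow_succ, Module.End.mul_apply, Module.End.mul_apply, ih]
    refine congrFun (congrArg _ (funext fun p => ?_)) s
    simp

theorem diffOp_const (i : Fin m) (c : L) : diffOp L i (fun _ => c) = 0 := by
  ext s; simp

theorem diffOp_pow_succ_const (i : Fin m) (k : ℕ) (c : L) :
    (diffOp L i ^ (k + 1)) (fun _ => c) = 0 := by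
  rw [pow_succ, Module.End.mul_apply, diffOp_const, map_zero]

theorem eq_base_add_single (s : LExp m) (i : Fin m) :
    ∃ p : LExp m, p i = 0 ∧ s = p + Pi.single i (s i) :=
  ⟨s - Pi.single i (s i), by simp, by simp⟩

theorem shiftOp_mul (i : Fin m) (r p : ℤ) :
    shiftOp L i r * shiftOp L i p = shiftOp L i (r + p) := by
  refine LinearMap.ext fun f => funext fun s => ?_
  simp [add_assoc, ← Pi.single_add]

theorem diffOp_pow_apply_add (i : Fin m) (k : ℕ) (f : LExp m → L) (s : LExp m) (r : ℤ) :
    (diffOp L i ^ k) f (s + Pi.single i r) = (diffOp L i ^ k) (shiftOp L i r f) s := by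
  have := ((commute_diffOp_shiftOp (L := L) i i r).pow_left k).eq
  exact (congrFun (LinearMap.congr_fun this f) s).symm

/-- A family on which one-directional vector fields act as on functions is polynomial in that
direction as soon as one iterated difference eigenvalue is missing. -/
theorem diffOp_pow_eq_zero_of_scalar (f : LExp m → L) (i : Fin m) (φ : ℤ → L →ₗ[ℂ] L)
    (h : ∀ r s, φ r (f s) = (s i : ℂ) • (f (s + Pi.single i r) - f s)) (K : ℕ)
    (hK : ∀ w, φ (-1) w = (-((K : ℂ) + 1)) • w → w = 0) :
    (diffOp L i ^ (K + 1)) f = 0 := by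
  have key : ∀ (r : ℤ) (p : LExp m), p i = 0 → φ r ((diffOp L i ^ (K + 1)) f p)
      = ((K : ℂ) + 1) • ((diffOp L i ^ K) f (p + Pi.single i (r + 1))
          - (diffOp L i ^ K) f (p + Pi.single i 1)) := by
    intro r p hp
    have hf : (fun s => φ r (f s)) = coordOp L i (shiftOp L i r f - f) := by
      ext s; simp [h]
    rw [map_diffOp_pow, hf, ← Module.End.mul_apply, diffOp_pow_mul_coordOp]
    simp only [LinearMap.add_apply, Pi.add_apply, Module.End.mul_apply, coordOp_apply, hp,
      Int.cast_zero, zero_smul, zero_add, LinearMap.smul_apply, Pi.smul_apply, map_sub,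
      Pi.sub_apply, shiftOp_apply]
    rw [← diffOp_pow_apply_add, add_assoc, ← Pi.single_add, add_comm 1 r, smul_sub]
  have hpow : ∀ p : LExp m, (diffOp L i ^ (K + 1)) f p
      = (diffOp L i ^ K) f (p + Pi.single i 1) - (diffOp L i ^ K) f p := by
    intro p
    rw [pow_succ', Module.End.mul_apply, diffOp_apply]
  have base : ∀ p : LExp m, p i = 0 → (diffOp L i ^ (K + 1)) f p = 0 := by
    intro p hp
    apply hK
    rw [key _ _ hp, hpow]
    simp only [Int.reduceNeg, neg_add_cancel, Pi.single_zero, add_zero]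
    module
  have hne : ((K : ℂ) + 1) ≠ 0 := Nat.cast_add_one_ne_zero K
  have const : ∀ (p : LExp m), p i = 0 → ∀ r : ℤ,
      (diffOp L i ^ K) f (p + Pi.single i r) = (diffOp L i ^ K) f (p + Pi.single i 1) := by
    intro p hp r
    have h1 := key (r - 1) p hp
    rw [base p hp, map_zero, sub_add_cancel] at h1
    exact sub_eq_zero.mp ((smul_eq_zero.mp h1.symm).resolve_left hne)
  ext s
  obtain ⟨p, hp, hs⟩ := eq_base_add_single s i
  rw [hpow, hs, add_assoc, ← Pi.single_add, const p hp, const p hp (s i), sub_self, Pi.zero_apply]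

/-- The analogue of `diffOp_pow_eq_zero_of_scalar` for families on which one-directional vector
fields act as on vector fields in the same direction. -/
theorem diffOp_pow_eq_zero_of_vector (f : LExp m → L) (i : Fin m) (φ : ℤ → L →ₗ[ℂ] L)
    (κ : ℤ → L)
    (h : ∀ r s, φ r (f s) = ((s i : ℂ) - 1 - r) • f (s + Pi.single i r)
      - ((s i : ℂ) - 1) • f s + κ r) (K : ℕ)
    (hK : ∀ w, φ (-1) w = (-(K : ℂ)) • w → w = 0)
    (hK' : ∀ w, φ (-1) w = (-((K : ℂ) + 1)) • w → w = 0) :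
    (diffOp L i ^ (K + 1)) f = 0 := by
  have key : ∀ (k : ℕ) (r : ℤ) (p : LExp m), p i = 0 → φ r ((diffOp L i ^ (k + 1)) f p)
      = ((k : ℂ) + 1) • ((diffOp L i ^ k) f (p + Pi.single i (r + 1))
          - (diffOp L i ^ k) f (p + Pi.single i 1))
        - (1 + (r : ℂ)) • (diffOp L i ^ (k + 1)) f (p + Pi.single i r)
        + (diffOp L i ^ (k + 1)) f p := by
    intro k r p hp
    have hf : (fun s => φ r (f s)) = coordOp L i (shiftOp L i r f - f)
        - (1 + (r : ℂ)) • shiftOp L i r f + f + fun _ => κ r := by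
      ext s
      simp only [h, Pi.add_apply, Pi.sub_apply, coordOp_apply, shiftOp_apply, Pi.smul_apply]
      module
    rw [map_diffOp_pow, hf, map_add, diffOp_pow_succ_const, add_zero, map_add, map_sub,
      ← Module.End.mul_apply _ (coordOp L i), diffOp_pow_mul_coordOp]
    simp only [LinearMap.add_apply, Pi.add_apply, Module.End.mul_apply, coordOp_apply, hp,
      Int.cast_zero, zero_smul, zero_add, LinearMap.smul_apply, Pi.smul_apply, map_sub,
      Pi.sub_apply, shiftOp_apply, map_smul]
    rw [← diffOp_pow_apply_add, ← diffOp_pow_apply_add, add_assoc, ← Pi.single_add, add_comm 1 r,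
      smul_sub]
  have hpow : ∀ (k : ℕ) (p : LExp m), (diffOp L i ^ (k + 1)) f p
      = (diffOp L i ^ k) f (p + Pi.single i 1) - (diffOp L i ^ k) f p := by
    intro k p
    rw [pow_succ', Module.End.mul_apply, diffOp_apply]
  have base : ∀ k : ℕ, (∀ w, φ (-1) w = (-(k : ℂ)) • w → w = 0) →
      ∀ p : LExp m, p i = 0 → (diffOp L i ^ (k + 1)) f p = 0 := by
    intro k hk p hp
    apply hk
    rw [key _ _ _ hp, hpow k p]
    simp only [Int.reduceNeg, neg_add_cancel, Pi.single_zero, add_zero]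
    push_cast
    module
  have base1 := base K hK
  have base2 := base (K + 1) (by exact_mod_cast hK')
  have main : ∀ p : LExp m, p i = 0 → ∀ r : ℤ,
      (diffOp L i ^ (K + 1)) f (p + Pi.single i (r + 1)) = 0 := by
    intro p hp r
    have e1 := key K r p hp
    have e1' := key K (r + 1) p hp
    have e2 := key (K + 1) r p hp
    have b3 := base1 p hp
    have b4 := base2 p hp
    rw [b3, map_zero] at e1 e1'
    rw [b4, map_zero] at e2
    have hs : ∀ (k : ℕ) (q : ℤ), (diffOp L i ^ (k + 1)) f (p + Pi.single i q)
        = (diffOp L i ^ k) f (p + Pi.single i (q + 1)) - (diffOp L i ^ k) f (p + Pi.single i q) := by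
      intro k q
      rw [hpow, add_assoc, ← Pi.single_add]
    have hb1 : (diffOp L i ^ (K + 1)) f (p + Pi.single i 1) = 0 := by
      have := hpow (K + 1) p
      rw [b4, b3, sub_zero] at this
      exact this.symm
    rw [hs (K + 1), hb1] at e2
    have e3 := hs K (r + 1)
    generalize (diffOp L i ^ (K + 1)) f (p + Pi.single i (r + 1)) = h1 at *
    generalize (diffOp L i ^ (K + 1)) f (p + Pi.single i r) = h0 at *
    generalize (diffOp L i ^ K) f (p + Pi.single i (r + 1)) = g1 at *
    generalize (diffOp L i ^ K) f (p + Pi.single i (r + 1 + 1)) = g2 at *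
    generalize (diffOp L i ^ K) f (p + Pi.single i 1) = g at *
    push_cast at e1 e1' e2
    have : (2 : ℂ) • h1 = 0 := by
      rw [e3] at e1' e2 ⊢
      linear_combination (norm := module) e1' - e1 - e2
    exact (smul_eq_zero.mp this).resolve_left two_ne_zero
  ext s
  obtain ⟨p, hp, hs⟩ := eq_base_add_single s i
  rw [hs, ← sub_add_cancel (s i) 1, main p hp, Pi.zero_apply]

theorem addSubgroup_eq_top (G : AddSubgroup (LExp m)) (h : ∀ i, Pi.single i 1 ∈ G) : G = ⊤ := by
  refine (AddSubgroup.eq_top_iff' G).mpr fun s => ?_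
  rw [← Finset.univ_sum_single s]
  refine G.sum_mem fun i _ => ?_
  have := G.zsmul_mem (h i) (s i)
  rwa [← Pi.single_smul, smul_eq_mul, mul_one] at this

/-- A family whose differences all lie in a submodule is constant modulo that submodule. -/
theorem sub_mem_of_diffOp_mem (P : Submodule ℂ L) (f : LExp m → L)
    (h : ∀ i s, diffOp L i f s ∈ P) (s p : LExp m) : f s - f p ∈ P := by
  let G : AddSubgroup (LExp m) :=
    { carrier := {r | ∀ s, f (s + r) - f s ∈ P}
      zero_mem' := by simp
      add_mem' := by
        intro a b ha hb s
        have := P.add_mem (hb (s + a)) (ha s)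
        rwa [sub_add_sub_cancel, add_assoc] at this
      neg_mem' := by
        intro a ha s
        have := P.neg_mem (ha (s + -a))
        simpa using this }
  have hG : G = ⊤ := addSubgroup_eq_top G fun i s => h i s
  have : s - p ∈ G := hG ▸ AddSubgroup.mem_top _
  simpa using this p

theorem eq_of_diffOp_eq_zero (f : LExp m → L) (h : ∀ i, diffOp L i f = 0) (s p : LExp m) :
    f s = f p := by
  have := sub_mem_of_diffOp_mem (⊥ : Submodule ℂ L) f (fun i s => by rw [h i]; exact zero_mem _) s p
  exact sub_eq_zero.mp ((Submodule.mem_bot ℂ).mp this)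

theorem eq_affine_of_diffOp_diffOp_eq_zero (f : LExp m → L)
    (h : ∀ i j, diffOp L i (diffOp L j f) = 0) (s : LExp m) :
    f s = f 0 + ∑ i, (s i : ℂ) • (f (Pi.single i 1) - f 0) := by
  let g : LExp m → L := fun s => f s - ∑ i, (s i : ℂ) • (f (Pi.single i 1) - f 0)
  have hg : ∀ i, diffOp L i g = 0 := by
    intro i
    ext s
    have h1 : diffOp L i f s = diffOp L i f 0 :=
      eq_of_diffOp_eq_zero _ (fun j => h j i) s 0
    have h2 : ∑ j, (((s + Pi.single i 1 : LExp m) j : ℤ) : ℂ) • (f (Pi.single j 1) - f 0)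
        = ∑ j, (s j : ℂ) • (f (Pi.single j 1) - f 0) + (f (Pi.single i 1) - f 0) := by
      have : ∀ j, (((s + Pi.single i 1 : LExp m) j : ℤ) : ℂ) • (f (Pi.single j 1) - f 0)
          = (s j : ℂ) • (f (Pi.single j 1) - f 0)
            + if j = i then f (Pi.single i 1) - f 0 else 0 := by
        intro j
        by_cases hj : j = i
        · subst hj; simp [add_smul]
        · simp [hj]
      rw [Finset.sum_congr rfl fun j _ => this j, Finset.sum_add_distrib]
      simp
    simp only [diffOp_apply, zero_add] at h1
    simp only [g, diffOp_apply, h2, Pi.zero_apply]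
    rw [← h1]
    abel
  have := eq_of_diffOp_eq_zero g hg s 0
  simp only [g, Pi.zero_apply, Int.cast_zero, zero_smul, Finset.sum_const_zero, sub_zero] at this
  exact sub_eq_iff_eq_add.mp this

end Differences

section IteratedDifferences

variable {m : ℕ} {L : Type*} [AddCommGroup L] [Module ℂ L]

/-- Iterated difference along a list of directions. -/
def iterDiff (L : Type*) [AddCommGroup L] [Module ℂ L] :
    List (Fin m) → Module.End ℂ (LExp m → L)
  | [] => 1
  | i :: l => diffOp L i * iterDiff L l

theorem commute_diffOp_iterDiff (i : Fin m) (l : List (Fin m)) :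
    Commute (diffOp L i) (iterDiff L l) := by
  induction l with
  | nil => exact Commute.one_right _
  | cons j l ih => exact (commute_diffOp i j).mul_right ih

theorem iterDiff_eq_zero_of_count (i : Fin m) (l : List (Fin m)) (f : LExp m → L) (K : ℕ)
    (hf : (diffOp L i ^ K) f = 0) (hK : K ≤ l.count i) : iterDiff L l f = 0 := by
  induction l generalizing f K with
  | nil =>
    obtain rfl : K = 0 := by simpa using hK
    exact hf
  | cons j l ih =>
    rw [iterDiff, (commute_diffOp_iterDiff j l).eq, Module.End.mul_apply]
    by_cases hj : j = i
    · subst hj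
      cases K with
      | zero =>
        have : f = 0 := by simpa using hf
        simp [this]
      | succ K =>
        refine ih _ K ?_ (by simpa using hK)
        rwa [← Module.End.mul_apply, ← pow_succ]
    · refine ih _ K ?_ (by simpa [List.count_cons, hj] using hK)
      rw [← Module.End.mul_apply, ((commute_diffOp i j).pow_left K).eq, Module.End.mul_apply, hf,
        map_zero]

theorem iterDiff_eq_zero_of_pow (f : LExp m → L) (K : ℕ) (hf : ∀ i, (diffOp L i ^ K) f = 0)
    (l : List (Fin m)) (hl : m * K + 1 ≤ l.length) : iterDiff L l f = 0 := by
  obtain ⟨i, hi⟩ : ∃ i, K ≤ l.count i := by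
    by_contra! h
    have h1 : ∑ i, l.count i = l.length := by
      simpa using Multiset.sum_count_eq_card (s := Finset.univ) (m := (l : Multiset (Fin m)))
        (fun _ _ => Finset.mem_univ _)
    have h2 : ∑ i, l.count i ≤ ∑ _i : Fin m, K := Finset.sum_le_sum fun i _ => (h i).le
    simp at h2
    omega
  exact iterDiff_eq_zero_of_count i l f K (hf i) hi

theorem map_iterDiff {L' : Type*} [AddCommGroup L'] [Module ℂ L'] (φ : L →ₗ[ℂ] L')
    (l : List (Fin m)) (f : LExp m → L) (s : LExp m) :
    φ (iterDiff L l f s) = iterDiff L' l (fun p => φ (f p)) s := by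
  induction l generalizing s with
  | nil => rfl
  | cons i l ih => simp only [iterDiff, Module.End.mul_apply, diffOp_apply, map_sub, ih]

theorem iterDiff_const {l : List (Fin m)} (hl : l ≠ []) (c : L) :
    iterDiff L l (fun _ => c) = 0 := by
  obtain ⟨i, l, rfl⟩ := List.exists_cons_of_ne_nil hl
  rw [iterDiff, (commute_diffOp_iterDiff i l).eq, Module.End.mul_apply, diffOp_const, map_zero]

/-- The discrete Euler operator. -/
def eulerOp (L : Type*) [AddCommGroup L] [Module ℂ L] (m : ℕ) : Module.End ℂ (LExp m → L) :=
  ∑ i, coordOp L i * (1 - shiftOp L i (-1))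

theorem diffOp_mul_eulerOp (j : Fin m) :
    diffOp L j * eulerOp L m = eulerOp L m * diffOp L j + diffOp L j := by
  have h : ∀ i, diffOp L j * (coordOp L i * (1 - shiftOp L i (-1)))
      = coordOp L i * (1 - shiftOp L i (-1)) * diffOp L j + if i = j then diffOp L j else 0 := by
    intro i
    have hc : Commute (diffOp L j) (1 - shiftOp L i (-1)) :=
      (Commute.one_right _).sub_right (commute_diffOp_shiftOp _ _ _)
    split_ifs with hij
    · subst hij
      rw [← mul_assoc, diffOp_mul_coordOp, add_mul, mul_assoc, hc.eq, ← mul_assoc,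
        mul_sub (shiftOp L i 1), mul_one, shiftOp_mul, add_neg_cancel, shiftOp_zero, ← diffOp]
    · rw [← mul_assoc, diffOp_mul_coordOp_of_ne hij, mul_assoc, hc.eq, ← mul_assoc, add_zero]
  simp [eulerOp, Finset.mul_sum, Finset.sum_mul, h, Finset.sum_add_distrib]

theorem iterDiff_mul_eulerOp (l : List (Fin m)) :
    iterDiff L l * eulerOp L m = eulerOp L m * iterDiff L l + (l.length : ℂ) • iterDiff L l := by
  induction l with
  | nil => simp [iterDiff]
  | cons i l ih =>
    rw [iterDiff, mul_assoc, ih, mul_add, ← mul_assoc, diffOp_mul_eulerOp, add_mul, mul_assoc,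
      mul_smul_comm, List.length_cons]
    push_cast
    module

theorem eulerOp_apply_zero (f : LExp m → L) : eulerOp L m f 0 = 0 := by
  simp [eulerOp, LinearMap.sum_apply, Finset.sum_apply]

end IteratedDifferences

section Eigenvalues

variable {V : Type*} [AddCommGroup V] [Module ℂ V]

theorem mem_maxGenEigenspace_of_commutator {E C : Module.End ℂ V} {c μ : ℂ}
    (h : E * C - C * E = c • C) {v : V} (hv : v ∈ E.maxGenEigenspace μ) :
    C v ∈ E.maxGenEigenspace (μ + c) := by
  rw [Module.End.mem_maxGenEigenspace] at hv ⊢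
  obtain ⟨k, hk⟩ := hv
  have hs : SemiconjBy C (E - μ • 1) (E - (μ + c) • 1) := by
    have hEC := sub_eq_iff_eq_add.mp h
    simp only [SemiconjBy, mul_sub, sub_mul, hEC, mul_smul_comm, smul_mul_assoc, mul_one, one_mul]
    module
  refine ⟨k, ?_⟩
  rw [← Module.End.mul_apply, ← (hs.pow_right k).eq, Module.End.mul_apply, hk, map_zero]

theorem maxGenEigenspace_eq_bot {E : Module.End ℂ V} {μ : ℂ} (h : ¬ E.HasEigenvalue μ) :
    E.maxGenEigenspace μ = ⊥ := by
  by_contra hne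
  obtain ⟨v, hv, hv0⟩ := Submodule.exists_mem_ne_zero_of_ne_bot hne
  have h0 : ∀ w, (E - μ • 1) w = 0 → w = 0 := by
    intro w hw
    by_contra hw0
    exact h (Module.End.hasEigenvalue_of_hasEigenvector (x := w)
      ⟨Module.End.mem_eigenspace_iff.mpr (by simpa [sub_eq_zero] using hw), hw0⟩)
  obtain ⟨k, hk⟩ := Module.End.mem_maxGenEigenspace _ _ _ |>.mp hv
  apply hv0
  clear hv hv0
  induction k with
  | zero => simpa using hk
  | succ k ih =>
    rw [pow_succ', Module.End.mul_apply] at hk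
    exact ih (h0 _ hk)

theorem finite_eigenvalues [FiniteDimensional ℂ V] (E : Module.End ℂ V) :
    {μ | E.HasEigenvalue μ}.Finite :=
  Module.End.finite_hasEigenvalue E

/-- There is an eigenvalue none of whose positive integer translates is an eigenvalue. -/
theorem exists_top_eigenvalue [FiniteDimensional ℂ V] [Nontrivial V] (E : Module.End ℂ V) :
    ∃ μ, E.HasEigenvalue μ ∧ ∀ j : ℕ, 1 ≤ j → ¬ E.HasEigenvalue (μ + j) := by
  obtain ⟨μ, hμ, hmax⟩ := Set.exists_max_image _ Complex.re (finite_eigenvalues E)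
    (Module.End.exists_eigenvalue E)
  refine ⟨μ, hμ, fun j hj h => ?_⟩
  have := hmax _ h
  have hj' : (1 : ℝ) ≤ j := by exact_mod_cast hj
  simp at this
  linarith

theorem exists_forall_not_eigenvalue [FiniteDimensional ℂ V] {ι : Type*} [Finite ι]
    (E : ι → Module.End ℂ V) : ∃ K : ℕ, ∀ i, ∀ k : ℕ, K ≤ k → ¬ (E i).HasEigenvalue (-(k : ℂ)) := by
  have hfin : {k : ℕ | ∃ i, (E i).HasEigenvalue (-(k : ℂ))}.Finite := by
    have : {k : ℕ | ∃ i, (E i).HasEigenvalue (-(k : ℂ))}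
        = ⋃ i, (fun k : ℕ => -(k : ℂ)) ⁻¹' {μ | (E i).HasEigenvalue μ} := by
      ext k; simp
    rw [this]
    refine Set.finite_iUnion fun i => (finite_eigenvalues (E i)).preimage ?_
    intro a _ b _ hab
    simpa using hab
  obtain ⟨B, hB⟩ := hfin.bddAbove
  exact ⟨B + 1, fun i k hk h => by have := hB ⟨i, h⟩; omega⟩

end Eigenvalues

section Vanishing

variable {m : ℕ} {V : Type*} [AddCommGroup V] [Module ℂ V]

theorem commutator_iterDiff_zero {E : Module.End ℂ V} {f : LExp m → Module.End ℂ V} {d : ℕ}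
    {κ : Module.End ℂ V} (hκ : d ≠ 0 → κ = 0)
    (h : ∀ s, E * f s - f s * E
      = ∑ i, (s i : ℂ) • (f s - f (s + Pi.single i (-1))) + ((d : ℂ) - 1) • f s + κ)
    (l : List (Fin m)) (hl : 1 ≤ d + l.length) :
    E * iterDiff _ l f 0 - iterDiff _ l f 0 * E
      = (((d + l.length : ℕ) : ℂ) - 1) • iterDiff _ l f 0 := by
  have h1 := map_iterDiff (LinearMap.mulLeft ℂ E - LinearMap.mulRight ℂ E) l f 0
  have hf : (fun p => (LinearMap.mulLeft ℂ E - LinearMap.mulRight ℂ E) (f p))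
      = eulerOp _ m f + ((d : ℂ) - 1) • f + fun _ => κ := by
    ext1 s
    simp [eulerOp, h, LinearMap.sum_apply, Finset.sum_apply, smul_sub]
  have hc : iterDiff (Module.End ℂ V) l (fun _ => κ) = 0 := by
    rcases eq_or_ne l [] with rfl | hne
    · rw [hκ (by simp at hl; omega)]
      exact map_zero _
    · exact iterDiff_const hne κ
  rw [hf, map_add, hc, add_zero, map_add, ← Module.End.mul_apply _ (eulerOp _ m),
    iterDiff_mul_eulerOp] at h1
  simp only [LinearMap.sub_apply, LinearMap.mulLeft_apply, LinearMap.mulRight_apply, Pi.add_apply,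
    LinearMap.add_apply, Module.End.mul_apply, eulerOp_apply_zero, zero_add, map_smul,
    LinearMap.smul_apply, Pi.smul_apply] at h1
  rw [h1]
  push_cast
  module

/-- Polynomial families of operators on an irreducible finite-dimensional space, graded by the
commutator with a fixed operator, vanish in total degree at least two. -/
theorem iterDiff_eq_zero_of_irreducible [FiniteDimensional ℂ V] [Nontrivial V] {ι : Type*}
    (E : Module.End ℂ V) (d : ι → ℕ) (f : ι → LExp m → Module.End ℂ V)
    (κ : ι → Module.End ℂ V) (hκ : ∀ x, d x ≠ 0 → κ x = 0)
    (h : ∀ x s, E * f x s - f x s * E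
      = ∑ i, (s i : ℂ) • (f x s - f x (s + Pi.single i (-1))) + ((d x : ℂ) - 1) • f x s + κ x)
    (R : ℕ) (hR : ∀ x l, R ≤ l.length → iterDiff _ l (f x) = 0)
    (hirr : ∀ U : Submodule ℂ V, U ≠ ⊥ → (∀ x s, ∀ v ∈ U, f x s v ∈ U) → U = ⊤)
    (hscalar : ∀ x, d x = 0 → ∃ s, ∃ c : ℂ, f x s = c • 1)
    (x : ι) (l : List (Fin m)) (hl : 2 ≤ d x + l.length) : iterDiff _ l (f x) = 0 := by
  obtain ⟨μ, hμ, htop⟩ := exists_top_eigenvalue E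
  set U := E.maxGenEigenspace μ with hU
  have hUne : U ≠ ⊥ := by
    obtain ⟨v, hv⟩ := hμ.exists_hasEigenvector
    refine (Submodule.ne_bot_iff _).mpr ⟨v, ?_, hv.2⟩
    exact (Module.End.mem_maxGenEigenspace _ _ _).mpr
      ⟨1, by simpa [sub_eq_zero] using hv.apply_eq_smul⟩
  have hvan : ∀ x l, 2 ≤ d x + l.length → ∀ v ∈ U, iterDiff _ l (f x) 0 v = 0 := by
    intro x l hl v hv
    have h1 := mem_maxGenEigenspace_of_commutator
      (commutator_iterDiff_zero (hκ x) (h x) l (by omega)) hv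
    have h2 := htop (d x + l.length - 1) (by omega)
    rw [Nat.cast_sub (by omega), Nat.cast_one] at h2
    rwa [maxGenEigenspace_eq_bot h2, Submodule.mem_bot] at h1
  let P : Submodule ℂ (Module.End ℂ V) :=
    { carrier := {C | ∀ v ∈ U, C v ∈ U}
      add_mem' := fun ha hb v hv => U.add_mem (ha v hv) (hb v hv)
      zero_mem' := fun v _ => U.zero_mem
      smul_mem' := fun c _ ha v hv => U.smul_mem c (ha v hv) }
  have hP : ∀ k l x, R ≤ l.length + k → 1 ≤ d x + l.length → ∀ s, iterDiff _ l (f x) s ∈ P := by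
    intro k
    induction k with
    | zero =>
      intro l x hl _ s
      rw [hR x l hl]
      exact P.zero_mem
    | succ k ih =>
      intro l x hl hd s
      have h1 := sub_mem_of_diffOp_mem P (iterDiff _ l (f x))
        (fun i s => ih (i :: l) x (by simp; omega) (by simp; omega) s) s 0
      have h0 : iterDiff _ l (f x) 0 ∈ P := by
        rcases Nat.lt_or_ge 1 (d x + l.length) with h2 | h2
        · intro v hv
          rw [hvan x l h2 v hv]
          exact U.zero_mem
        · intro v hv
          have h3 := mem_maxGenEigenspace_of_commutator
            (commutator_iterDiff_zero (hκ x) (h x) l hd) hv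
          rwa [le_antisymm h2 hd, Nat.cast_one, sub_self, add_zero] at h3
      simpa using P.add_mem h1 h0
  have hUtop : U = ⊤ := by
    refine hirr U hUne fun x s => ?_
    change f x s ∈ P
    rcases Nat.eq_zero_or_pos (d x) with hd | hd
    · obtain ⟨s0, c, hc⟩ := hscalar x hd
      have h1 := sub_mem_of_diffOp_mem P (f x)
        (fun i s => hP R [i] x (by simp) (by simp) s) s s0
      have h0 : f x s0 ∈ P := by
        intro v hv
        rw [hc]
        exact U.smul_mem c hv
      simpa using P.add_mem h1 h0
    · exact hP R [] x (by simp) (by simpa using Nat.succ_le_of_lt hd) s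
  have main : ∀ k l, R ≤ l.length + k → 2 ≤ d x + l.length → iterDiff _ l (f x) = 0 := by
    intro k
    induction k with
    | zero => exact fun l hl _ => hR x l hl
    | succ k ih =>
      intro l hl hd
      ext1 s
      rw [eq_of_diffOp_eq_zero (iterDiff _ l (f x))
        (fun i => ih (i :: l) (by simp; omega) (by simp; omega)) s 0]
      refine LinearMap.ext fun v => hvan x l hd v ?_
      rw [hUtop]
      trivial
  exact main R l (by omega) hl

end Vanishing

section Degree

variable {m n : ℕ} {V : Type*} [AddCommGroup V] [Module ℂ V]

/-- The coordinates of the action of `t^s ξ^q D` along the pure monomials, seen as operators on the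
space of lowest vectors, satisfy these relations. -/
structure IsCoordFamily (lam : Fin m → ℂ)
    (Z : LExp m → GExp n → Dir m n false → Module.End ℂ V) : Prop where
  di_di : ∀ (r s : LExp m) (q : GExp n) (i j : Fin m),
    Z r (gzero n) (.di i) * Z s q (.di j) - Z s q (.di j) * Z r (gzero n) (.di i)
      = (s i : ℂ) • (Z (s + r) q (.di j) - Z s q (.di j))
        - (r j : ℂ) • (Z (s + r) q (.di i) - if q = gzero n then Z r (gzero n) (.di i) else 0)
  di_pa : ∀ (r s : LExp m) (q : GExp n) (i : Fin m) (β : Fin n),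
    Z r (gzero n) (.di i) * Z s q (.pa β) - Z s q (.pa β) * Z r (gzero n) (.di i)
      = (s i : ℂ) • (Z (s + r) q (.pa β) - Z s q (.pa β))
  pa_di : ∀ (α : Fin n) (s : LExp m) (q : GExp n) (j : Fin m),
    Z 0 (gsingle α) (.pa α) * Z s q (.di j) - Z s q (.di j) * Z 0 (gsingle α) (.pa α)
      = (if q α then (1 : ℂ) else 0) • Z s q (.di j)
  pa_pa : ∀ (α : Fin n) (s : LExp m) (q : GExp n) (β : Fin n),
    Z 0 (gsingle α) (.pa α) * Z s q (.pa β) - Z s q (.pa β) * Z 0 (gsingle α) (.pa α)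
      = ((if q α then (1 : ℂ) else 0) - if β = α then 1 else 0) • Z s q (.pa β)
  di_zero : ∀ i, Z 0 (gzero n) (.di i) = lam i • 1
  pa_zero : ∀ β, Z 0 (gzero n) (.pa β) = 0
  irred : ∀ U : Submodule ℂ V, U ≠ ⊥ → (∀ s q D, ∀ v ∈ U, Z s q D v ∈ U) → U = ⊤

variable {lam : Fin m → ℂ} {Z : LExp m → GExp n → Dir m n false → Module.End ℂ V}

/-- The coordinate family, shifted so that it becomes polynomial of the expected degree. -/
def shiftedCoord (Z : LExp m → GExp n → Dir m n false → Module.End ℂ V)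
    (x : GExp n × Dir m n false) (s : LExp m) : Module.End ℂ V :=
  match x.2 with
  | .di j => Z (s - Pi.single j 1) x.1 (.di j)
  | .pa β => Z s x.1 (.pa β)

theorem shiftedCoord_di (q : GExp n) (j : Fin m) (s : LExp m) :
    shiftedCoord Z (q, .di j) (s + Pi.single j 1) = Z s q (.di j) :=
  congrArg (fun s => Z s q (.di j)) (add_sub_cancel_right s _)

theorem sum_exponents (q : GExp n) : ∑ α, (if q α then (1 : ℂ) else 0) = gdeg q := by
  simp [gdeg]

theorem IsCoordFamily.exists_pow [FiniteDimensional ℂ V] (hZ : IsCoordFamily lam Z) :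
    ∃ K : ℕ, ∀ x i, (diffOp _ i ^ K) (shiftedCoord Z x) = 0 := by
  let φ : Fin m → ℤ → Module.End ℂ (Module.End ℂ V) := fun i r =>
    LinearMap.mulLeft ℂ (Z (Pi.single i r) (gzero n) (.di i))
      - LinearMap.mulRight ℂ (Z (Pi.single i r) (gzero n) (.di i))
  have hφ : ∀ i r C, φ i r C = Z (Pi.single i r) (gzero n) (.di i) * C
      - C * Z (Pi.single i r) (gzero n) (.di i) := fun i r C => rfl
  obtain ⟨K, hK⟩ := exists_forall_not_eigenvalue fun i => φ i (-1)
  have hK' : ∀ i (k : ℕ), K ≤ k → ∀ w, φ i (-1) w = (-(k : ℂ)) • w → w = 0 := by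
    intro i k hk w hw
    by_contra hw0
    exact hK i k hk (Module.End.hasEigenvalue_of_hasEigenvector
      ⟨Module.End.mem_eigenspace_iff.mpr hw, hw0⟩)
  refine ⟨K + 1, ?_⟩
  rintro ⟨q, D⟩ i
  cases D with
  | pa β =>
    refine diffOp_pow_eq_zero_of_scalar _ i (φ i) (fun r s => ?_) K fun w hw =>
      hK' i (K + 1) (by omega) w (by exact_mod_cast hw)
    rw [hφ, shiftedCoord, hZ.di_pa]
    rfl
  | di j =>
    by_cases hij : i = j
    · subst hij
      refine diffOp_pow_eq_zero_of_vector _ i (φ i)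
        (fun r => (r : ℂ) • if q = gzero n then Z (Pi.single i r) (gzero n) (.di i) else 0)
        (fun r s => ?_) K (hK' i K le_rfl)
        fun w hw => hK' i (K + 1) (by omega) w (by exact_mod_cast hw)
      rw [hφ]
      simp only [shiftedCoord]
      rw [hZ.di_di, sub_add_eq_add_sub]
      simp only [Pi.sub_apply, Pi.single_eq_same]
      push_cast
      module
    · refine diffOp_pow_eq_zero_of_scalar _ i (φ i) (fun r s => ?_) K fun w hw =>
        hK' i (K + 1) (by omega) w (by exact_mod_cast hw)
      rw [hφ]
      simp only [shiftedCoord]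
      rw [hZ.di_di, sub_add_eq_add_sub]
      simp [hij, Ne.symm hij]

theorem IsCoordFamily.iterDiff_eq_zero [FiniteDimensional ℂ V] [Nontrivial V]
    (hZ : IsCoordFamily lam Z) (x : GExp n × Dir m n false) (l : List (Fin m))
    (hl : 2 ≤ gdeg x.1 + l.length) : iterDiff _ l (shiftedCoord Z x) = 0 := by
  obtain ⟨K, hK⟩ := hZ.exists_pow
  refine iterDiff_eq_zero_of_irreducible
    (∑ α, Z 0 (gsingle α) (.pa α) - ∑ i, Z (Pi.single i (-1)) (gzero n) (.di i))
    (fun x => gdeg x.1) (shiftedCoord Z)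
    (fun x => if x.1 = gzero n then shiftedCoord Z x 0 else 0) ?_ ?_ (m * K + 1)
    (fun x l hl => iterDiff_eq_zero_of_pow _ K (hK x) l hl) ?_ ?_ x l hl
  · intro x hx
    rw [if_neg]
    intro h
    simp [h, gdeg_gzero] at hx
  · rintro ⟨q, D⟩ s
    have e : ∀ C : Module.End ℂ V,
        (∑ α, Z 0 (gsingle α) (.pa α) - ∑ i, Z (Pi.single i (-1)) (gzero n) (.di i)) * C
        - C * (∑ α, Z 0 (gsingle α) (.pa α) - ∑ i, Z (Pi.single i (-1)) (gzero n) (.di i))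
        = ∑ α, (Z 0 (gsingle α) (.pa α) * C - C * Z 0 (gsingle α) (.pa α))
          - ∑ i, (Z (Pi.single i (-1)) (gzero n) (.di i) * C
            - C * Z (Pi.single i (-1)) (gzero n) (.di i)) := by
      intro C
      simp only [sub_mul, mul_sub, Finset.sum_mul, Finset.mul_sum, Finset.sum_sub_distrib]
      abel
    rw [e]
    cases D with
    | pa β =>
      simp only [shiftedCoord, hZ.di_pa, hZ.pa_pa]
      rw [← Finset.sum_smul, Finset.sum_sub_distrib, sum_exponents]
      have h0 : (if q = gzero n then Z 0 q (.pa β) else 0) = 0 := by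
        split_ifs with hq
        · rw [hq, hZ.pa_zero]
        · rfl
      rw [h0]
      simp only [Finset.sum_ite_eq, Finset.mem_univ, if_true, add_zero]
      rw [sub_eq_add_neg, add_comm, ← Finset.sum_neg_distrib]
      congr 1
      exact Finset.sum_congr rfl fun i _ => by module
    | di j =>
      simp only [shiftedCoord, hZ.di_di, hZ.pa_di]
      rw [← Finset.sum_smul, sum_exponents]
      have h1 : ∀ i : Fin m, ((s - Pi.single j 1 : LExp m) i : ℂ) •
            (Z (s - Pi.single j 1 + Pi.single i (-1)) q (.di j) - Z (s - Pi.single j 1) q (.di j))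
          - ((Pi.single i (-1) : LExp m) j : ℂ) •
            (Z (s - Pi.single j 1 + Pi.single i (-1)) q (.di i)
              - if q = gzero n then Z (Pi.single i (-1)) (gzero n) (.di i) else 0)
          = -((s i : ℂ) • (Z (s - Pi.single j 1) q (.di j)
              - Z (s + Pi.single i (-1) - Pi.single j 1) q (.di j)))
            + if i = j then Z (s - Pi.single j 1) q (.di j)
                - (if q = gzero n then Z (0 - Pi.single j 1) q (.di j) else 0) else 0 := by
        intro i
        rw [sub_add_eq_add_sub]
        by_cases hij : i = j
        · subst hij
          have hneg : (Pi.single i (-1) : LExp m) = 0 - Pi.single i 1 := by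
            rw [zero_sub, Pi.single_neg]
          rw [if_pos rfl]
          split_ifs with hq
          · subst hq
            rw [hneg]
            simp only [Pi.sub_apply, Pi.single_eq_same, Pi.zero_apply]
            push_cast
            module
          · simp only [Pi.sub_apply, Pi.single_eq_same]
            push_cast
            module
        · simp [hij, Ne.symm hij, smul_sub]
      rw [Finset.sum_congr rfl fun i _ => h1 i, Finset.sum_add_distrib, Finset.sum_neg_distrib]
      simp only [Finset.sum_ite_eq', Finset.mem_univ, if_true]
      module
  · intro U hU h
    refine hZ.irred U hU ?_
    rintro s q (j | β) v hv
    · have := h (q, .di j) (s + Pi.single j 1) v hv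
      rwa [shiftedCoord_di] at this
    · exact h (q, .pa β) s v hv
  · rintro ⟨q, D⟩ hq
    obtain rfl := gdeg_eq_zero.mp hq
    cases D with
    | pa β => exact ⟨0, 0, by simp [shiftedCoord, hZ.pa_zero]⟩
    | di j => exact ⟨0 + Pi.single j 1, lam j, by rw [shiftedCoord_di, hZ.di_zero]⟩

theorem IsCoordFamily.eq_zero [FiniteDimensional ℂ V] [Nontrivial V] (hZ : IsCoordFamily lam Z)
    (s : LExp m) (q : GExp n) (D : Dir m n false) (hq : 2 ≤ gdeg q) : Z s q D = 0 := by
  have h := hZ.iterDiff_eq_zero (q, D) [] (by simpa using hq)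
  cases D with
  | pa β => exact congrFun h s
  | di j => exact (shiftedCoord_di q j s).symm.trans (congrFun h (s + Pi.single j 1))

theorem IsCoordFamily.eq_const [FiniteDimensional ℂ V] [Nontrivial V] (hZ : IsCoordFamily lam Z)
    (s : LExp m) (q : GExp n) (D : Dir m n false) (hq : gdeg q = 1) : Z s q D = Z 0 q D := by
  have h := eq_of_diffOp_eq_zero (shiftedCoord Z (q, D))
    (fun i => hZ.iterDiff_eq_zero (q, D) [i] (by simp [hq]))
  cases D with
  | pa β => exact h s 0
  | di j => 
    rw [← shiftedCoord_di (Z := Z) q j s, ← shiftedCoord_di (Z := Z) q j 0]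
    exact h _ _

theorem IsCoordFamily.di_eq_affine [FiniteDimensional ℂ V] [Nontrivial V]
    (hZ : IsCoordFamily lam Z) (s : LExp m) (j : Fin m) :
    Z s (gzero n) (.di j) = lam j • 1
      + ∑ i, (s i : ℂ) • (Z (Pi.single i 1) (gzero n) (.di j) - lam j • 1) := by
  have h := eq_affine_of_diffOp_diffOp_eq_zero
    (shiftOp _ j 1 (shiftedCoord Z (gzero n, .di j))) (fun i k => by
      have h := hZ.iterDiff_eq_zero (gzero n, .di j) [i, k] (by simp)
      rw [← Module.End.mul_apply (diffOp _ k), (commute_diffOp_shiftOp k j 1).eq,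
        Module.End.mul_apply, ← Module.End.mul_apply (diffOp _ i),
        (commute_diffOp_shiftOp i j 1).eq, Module.End.mul_apply]
      exact (congrArg _ h).trans (map_zero _)) s
  simpa only [shiftOp_apply, shiftedCoord_di, hZ.di_zero] using h

theorem IsCoordFamily.pa_eq_linear [FiniteDimensional ℂ V] [Nontrivial V]
    (hZ : IsCoordFamily lam Z) (s : LExp m) (β : Fin n) :
    Z s (gzero n) (.pa β) = ∑ i, (s i : ℂ) • Z (Pi.single i 1) (gzero n) (.pa β) := by
  have h := eq_affine_of_diffOp_diffOp_eq_zero (shiftedCoord Z (gzero n, .pa β))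
    (fun i k => hZ.iterDiff_eq_zero (gzero n, .pa β) [i, k] (by simp)) s
  simpa [shiftedCoord, hZ.pa_zero] using h

end Degree

section Operators

variable {m n : ℕ} (ρ : AVRep m n false)

/-- Multiplication by a monomial of `A`. -/
def AVRep.a (x : ABasis m n) : Module.End ℂ ρ.M := ρ.aact (asng x)

/-- Action of a basis element of `W(m,n)`. -/
def AVRep.w (x : WBasis m n false) : Module.End ℂ ρ.M := ρ.act (sng x)

theorem AVRep.a_one (v : ρ.M) : ρ.a (0, gzero n) v = v :=
  LinearMap.congr_fun ρ.aact_one v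

theorem AVRep.a_a (r s : LExp m) (f g : GExp n) (v : ρ.M) :
    ρ.a (r, f) (ρ.a (s, g) v) = mulSgn f g • ρ.a (r + s, xorE f g) v := by
  have h := LinearMap.congr_fun (ρ.aact_mul (r, f) (s, g)) v
  simpa [amulB, AVRep.a] using h.symm

theorem AVRep.w_di_a (s r : LExp m) (f g : GExp n) (j : Fin m) (v : ρ.M) :
    ρ.w (s, f, .di j) (ρ.a (r, g) v)
      = ((r j : ℂ) * mulSgn f g) • ρ.a (s + r, xorE f g) v
        + (-1 : ℂ) ^ (gdeg f * gdeg g) • ρ.a (r, g) (ρ.w (s, f, .di j) v) := by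
  have h := LinearMap.congr_fun (ρ.leibniz (s, f, .di j) (r, g)) v
  simpa [AVRep.a, AVRep.w, wOnA, par, apar, neg_one_pow_mod_two_mul, neg_one_pow_mul_mod_two] using h

theorem AVRep.w_pa_a (s r : LExp m) (f g : GExp n) (β : Fin n) (v : ρ.M) :
    ρ.w (s, f, .pa β) (ρ.a (r, g) v)
      = (derC β g * mulSgn f (derE β g)) • ρ.a (s + r, xorE f (derE β g)) v
        + (-1 : ℂ) ^ ((gdeg f + 1) * gdeg g) • ρ.a (r, g) (ρ.w (s, f, .pa β) v) := by
  have h := LinearMap.congr_fun (ρ.leibniz (s, f, .pa β) (r, g)) v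
  simpa [AVRep.a, AVRep.w, wOnA, par, apar, neg_one_pow_mod_two_mul, neg_one_pow_mul_mod_two] using h

theorem AVRep.w_di_di (r p : LExp m) (s q : GExp n) (i j : Fin m) (v : ρ.M) :
    ρ.w (r, s, .di i) (ρ.w (p, q, .di j) v)
      = ((p i : ℂ) * mulSgn s q) • ρ.w (r + p, xorE s q, .di j) v
        - ((r j : ℂ) * mulSgn s q) • ρ.w (r + p, xorE s q, .di i) v
        + (-1 : ℂ) ^ (gdeg s * gdeg q) • ρ.w (p, q, .di j) (ρ.w (r, s, .di i) v) := by
  have h := LinearMap.congr_fun (ρ.super (r, s, .di i) (p, q, .di j)) v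
  simp only [brB, par, neg_one_pow_mod_two_mul, neg_one_pow_mul_mod_two, map_sub, map_smul,
    LinearMap.sub_apply, LinearMap.smul_apply, LinearMap.comp_apply] at h
  exact (sub_eq_iff_eq_add.mp h.symm)

theorem AVRep.w_di_pa (r p : LExp m) (s q : GExp n) (i : Fin m) (β : Fin n) (v : ρ.M) :
    ρ.w (r, s, .di i) (ρ.w (p, q, .pa β) v)
      = ((p i : ℂ) * mulSgn s q) • ρ.w (r + p, xorE s q, .pa β) v
        - ((-1 : ℂ) ^ (gdeg s * (gdeg q + 1)) * derC β s * mulSgn q (derE β s)) •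
            ρ.w (r + p, xorE q (derE β s), .di i) v
        + (-1 : ℂ) ^ (gdeg s * (gdeg q + 1)) • ρ.w (p, q, .pa β) (ρ.w (r, s, .di i) v) := by
  have h := LinearMap.congr_fun (ρ.super (r, s, .di i) (p, q, .pa β)) v
  simp only [brB, par, neg_one_pow_mod_two_mul, neg_one_pow_mul_mod_two, map_sub, map_smul,
    LinearMap.sub_apply, LinearMap.smul_apply, LinearMap.comp_apply] at h
  exact (sub_eq_iff_eq_add.mp h.symm)

theorem AVRep.w_pa_di (r p : LExp m) (s q : GExp n) (α : Fin n) (j : Fin m) (v : ρ.M) :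
    ρ.w (r, s, .pa α) (ρ.w (p, q, .di j) v)
      = (derC α q * mulSgn s (derE α q)) • ρ.w (r + p, xorE s (derE α q), .di j) v
        - ((-1 : ℂ) ^ ((gdeg s + 1) * gdeg q) * (r j : ℂ) * mulSgn q s) •
            ρ.w (r + p, xorE q s, .pa α) v
        + (-1 : ℂ) ^ ((gdeg s + 1) * gdeg q) • ρ.w (p, q, .di j) (ρ.w (r, s, .pa α) v) := by
  have h := LinearMap.congr_fun (ρ.super (r, s, .pa α) (p, q, .di j)) v
  simp only [brB, par, neg_one_pow_mod_two_mul, neg_one_pow_mul_mod_two, map_sub, map_smul,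
    LinearMap.sub_apply, LinearMap.smul_apply, LinearMap.comp_apply] at h
  exact (sub_eq_iff_eq_add.mp h.symm)

theorem AVRep.w_pa_pa (r p : LExp m) (s q : GExp n) (α β : Fin n) (v : ρ.M) :
    ρ.w (r, s, .pa α) (ρ.w (p, q, .pa β) v)
      = (derC α q * mulSgn s (derE α q)) • ρ.w (r + p, xorE s (derE α q), .pa β) v
        - ((-1 : ℂ) ^ ((gdeg s + 1) * (gdeg q + 1)) * derC β s * mulSgn q (derE β s)) •
            ρ.w (r + p, xorE q (derE β s), .pa α) v
        + (-1 : ℂ) ^ ((gdeg s + 1) * (gdeg q + 1)) •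
            ρ.w (p, q, .pa β) (ρ.w (r, s, .pa α) v) := by
  have h := LinearMap.congr_fun (ρ.super (r, s, .pa α) (p, q, .pa β)) v
  simp only [brB, par, neg_one_pow_mod_two_mul, neg_one_pow_mul_mod_two, map_sub, map_smul,
    LinearMap.sub_apply, LinearMap.smul_apply, LinearMap.comp_apply] at h
  exact (sub_eq_iff_eq_add.mp h.symm)

/-- The action of `d_i`. -/
def AVRep.dd (i : Fin m) : Module.End ℂ ρ.M := ρ.w (0, gzero n, .di i)

/-- The action of `∂_β`. -/
def AVRep.pd (β : Fin n) : Module.End ℂ ρ.M := ρ.w (0, gzero n, .pa β)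

theorem AVRep.dd_a (i : Fin m) (r : LExp m) (g : GExp n) (v : ρ.M) :
    ρ.dd i (ρ.a (r, g) v) = (r i : ℂ) • ρ.a (r, g) v + ρ.a (r, g) (ρ.dd i v) := by
  simp [AVRep.dd, w_di_a, gdeg_gzero]

theorem AVRep.pd_a (β : Fin n) (r : LExp m) (g : GExp n) (v : ρ.M) :
    ρ.pd β (ρ.a (r, g) v)
      = derC β g • ρ.a (r, derE β g) v + (-1 : ℂ) ^ gdeg g • ρ.a (r, g) (ρ.pd β v) := by
  simp [AVRep.pd, w_pa_a, gdeg_gzero]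

theorem AVRep.dd_w (i : Fin m) (s : LExp m) (q : GExp n) (D : Dir m n false) (v : ρ.M) :
    ρ.dd i (ρ.w (s, q, D) v) = (s i : ℂ) • ρ.w (s, q, D) v + ρ.w (s, q, D) (ρ.dd i v) := by
  cases D <;> rw [AVRep.dd] <;> [rw [w_di_di]; rw [w_di_pa]] <;> simp [gdeg_gzero]

theorem AVRep.pd_w (β : Fin n) (s : LExp m) (q : GExp n) (D : Dir m n false) (v : ρ.M) :
    ρ.pd β (ρ.w (s, q, D) v)
      = derC β q • ρ.w (s, derE β q, D) v
        + (-1 : ℂ) ^ par (s, q, D) • ρ.w (s, q, D) (ρ.pd β v) := by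
  cases D <;> rw [AVRep.pd] <;> [rw [w_pa_di]; rw [w_pa_pa]] <;>
    simp [gdeg_gzero, par, neg_one_pow_mod_two]

/-- Lowest vectors of weight `lam`: weight vectors killed by all `∂_β`. -/
def AVRep.lowest (lam : Fin m → ℂ) : Submodule ℂ ρ.M where
  carrier := {v | (∀ i, ρ.dd i v = lam i • v) ∧ ∀ β, ρ.pd β v = 0}
  add_mem' := fun ha hb => ⟨fun i => by rw [map_add, ha.1, hb.1, smul_add],
    fun β => by rw [map_add, ha.2, hb.2, add_zero]⟩
  zero_mem' := ⟨fun i => by simp, fun β => by simp⟩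
  smul_mem' := fun c v hv => ⟨fun i => by rw [map_smul, hv.1, smul_comm],
    fun β => by rw [map_smul, hv.2, smul_zero]⟩

/-- The map `A ⊗ V' → M` given by multiplication. -/
def AVRep.expand (lam : Fin m → ℂ) : (ABasis m n →₀ ρ.lowest lam) →ₗ[ℂ] ρ.M :=
  Finsupp.lsum ℂ fun x => ρ.a x ∘ₗ (ρ.lowest lam).subtype

@[simp] theorem AVRep.expand_single (lam : Fin m → ℂ) (x : ABasis m n) (v : ρ.lowest lam) :
    ρ.expand lam (Finsupp.single x v) = ρ.a x v := by
  simp [AVRep.expand]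

variable {ρ}

theorem exists_weight_vector (hw : IsWeightG ρ.g) (hne : ∃ v : ρ.M, v ≠ 0) :
    ∃ (lam : Fin m → ℂ) (v : ρ.M), v ≠ 0 ∧ ∀ i, ρ.dd i v = lam i • v := by
  by_contra! h
  have hbot : ∀ lam, wtG ρ.g lam = ⊥ := by
    intro lam
    refine (Submodule.eq_bot_iff _).mpr fun v hv => ?_
    by_contra hv0
    obtain ⟨i, hi⟩ := h (fun i => lam (.inl i)) v hv0
    refine hi ?_
    have := (Submodule.mem_iInf _).mp hv (.inl i)
    rw [LinearMap.mem_ker, LinearMap.sub_apply, sub_eq_zero] at this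
    exact this
  obtain ⟨v, hv⟩ := hne
  have htop : (⊥ : Submodule ℂ ρ.M) = ⊤ := by
    rw [← hw]
    simp [hbot]
  have : v ∈ (⊥ : Submodule ℂ ρ.M) := htop ▸ Submodule.mem_top
  exact hv (by simpa using this)

theorem AVIsSimple.eq_top (hs : AVIsSimple ρ) (N : Submodule ℂ ρ.M)
    (ha : ∀ x, ∀ v ∈ N, ρ.a x v ∈ N) (hwN : ∀ x, ∀ v ∈ N, ρ.w x v ∈ N) (hN : N ≠ ⊥) : N = ⊤ :=
  (hs.2 N ⟨hwN, ha⟩).resolve_left hN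

/-- All weights of a simple weight module lie in one coset of `ℤ^m`. -/
theorem span_weights_eq_top (hs : AVIsSimple ρ) {lam : Fin m → ℂ} {v : ρ.M} (hv : v ≠ 0)
    (hvw : ∀ i, ρ.dd i v = lam i • v) :
    Submodule.span ℂ {w : ρ.M | ∃ r : LExp m, ∀ i, ρ.dd i w = (lam i + r i) • w} = ⊤ := by
  have key : ∀ F : Module.End ℂ ρ.M, (∀ w, ∀ r : LExp m, (∀ i, ρ.dd i w = (lam i + r i) • w) →
      ∃ r : LExp m, ∀ i, ρ.dd i (F w) = (lam i + r i) • F w) →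
      ∀ w ∈ Submodule.span ℂ {w : ρ.M | ∃ r : LExp m, ∀ i, ρ.dd i w = (lam i + r i) • w},
      F w ∈ Submodule.span ℂ {w : ρ.M | ∃ r : LExp m, ∀ i, ρ.dd i w = (lam i + r i) • w} := by
    intro F hF w hw
    induction hw using Submodule.span_induction with
    | mem w hw =>
      obtain ⟨r, hr⟩ := hw
      exact Submodule.subset_span (hF w r hr)
    | zero => simp
    | add x y _ _ hx hy => rw [map_add]; exact Submodule.add_mem _ hx hy
    | smul c x _ hx => rw [map_smul]; exact Submodule.smul_mem _ c hx
  refine hs.eq_top _ ?_ ?_ ?_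
  · rintro ⟨p, g⟩
    refine key _ fun w r hr => ⟨r + p, fun i => ?_⟩
    rw [ρ.dd_a, hr, map_smul, ← add_smul]
    simp only [Pi.add_apply]
    push_cast
    congr 1
    ring
  · rintro ⟨p, g, D⟩
    refine key _ fun w r hr => ⟨r + p, fun i => ?_⟩
    rw [ρ.dd_w, hr, map_smul, ← add_smul]
    simp only [Pi.add_apply]
    push_cast
    congr 1
    ring
  · refine (Submodule.ne_bot_iff _).mpr ⟨v, Submodule.subset_span ⟨0, fun i => ?_⟩, hv⟩
    simp [hvw]

theorem AVRep.pd_pd (β α : Fin n) (v : ρ.M) : ρ.pd β (ρ.pd α v) = -ρ.pd α (ρ.pd β v) := by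
  conv_lhs => rw [AVRep.pd, AVRep.pd, w_pa_pa]
  simp [gdeg_gzero, AVRep.pd]

theorem AVRep.pd_pd_self (α : Fin n) (v : ρ.M) : ρ.pd α (ρ.pd α v) = 0 := by
  have h : (2 : ℂ) • ρ.pd α (ρ.pd α v) = 0 := by
    rw [two_smul]
    nth_rw 1 [ρ.pd_pd α α v]
    exact neg_add_cancel _
  exact (smul_eq_zero.mp h).resolve_left two_ne_zero

theorem AVRep.a_mem_range_expand {lam : Fin m → ℂ} (x : ABasis m n) {w : ρ.M}
    (hw : w ∈ LinearMap.range (ρ.expand lam)) : ρ.a x w ∈ LinearMap.range (ρ.expand lam) := by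
  obtain ⟨u, rfl⟩ := hw
  induction u using Finsupp.induction_linear with
  | zero => simp
  | add u u' hu hu' => rw [map_add, map_add]; exact Submodule.add_mem _ hu hu'
  | single y v =>
    rw [expand_single]
    refine ⟨mulSgn x.2 y.2 • Finsupp.single (x.1 + y.1, xorE x.2 y.2) v, ?_⟩
    rw [map_smul, expand_single]
    exact (ρ.a_a x.1 y.1 x.2 y.2 v).symm

/-- A weight vector is generated by lowest vectors. -/
theorem AVRep.mem_range_expand {lam : Fin m → ℂ} {r : LExp m} (S : Finset (Fin n)) (w : ρ.M)
    (hw : ∀ i, ρ.dd i w = (lam i + r i) • w) (hS : ∀ β, β ∉ S → ρ.pd β w = 0) :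
    w ∈ LinearMap.range (ρ.expand lam) := by
  induction S using Finset.induction_on generalizing w with
  | empty =>
    have h1 : w = ρ.a (r, gzero n) (ρ.a (-r, gzero n) w) := by
      rw [a_a]; simp [a_one]
    rw [h1]
    refine ρ.a_mem_range_expand _ ⟨Finsupp.single (0, gzero n) ⟨ρ.a (-r, gzero n) w, ?_, ?_⟩, ?_⟩
    · intro i
      rw [dd_a, hw, map_smul, ← add_smul]
      simp
    · intro β
      rw [pd_a, hS β (Finset.notMem_empty β)]
      simp
    · rw [expand_single, a_one]
  | insert α S _ ih =>
    have h1 : w = ρ.pd α (ρ.a (0, gsingle α) w) + ρ.a (0, gsingle α) (ρ.pd α w) := by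
      rw [pd_a]
      simp [derE_gsingle, gdeg_gsingle, a_one]
    have hdp : ∀ v : ρ.M, (∀ i, ρ.dd i v = (lam i + r i) • v) →
        ∀ i, ρ.dd i (ρ.pd α v) = (lam i + r i) • ρ.pd α v := by
      intro v hv i
      rw [AVRep.pd, dd_w, hv, map_smul]
      simp
    rw [h1]
    refine Submodule.add_mem _ (ih _ (hdp _ fun i => ?_) fun β hβ => ?_)
      (ρ.a_mem_range_expand _ (ih _ (hdp _ hw) fun β hβ => ?_))
    · rw [dd_a, hw, map_smul]
      simp
    · by_cases hβα : β = α
      · subst hβα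
        exact ρ.pd_pd_self _ _
      · rw [pd_pd, pd_a, hS β (by simp [hβ, hβα]), derC_gsingle_of_ne hβα]
        simp
    · by_cases hβα : β = α
      · subst hβα
        exact ρ.pd_pd_self _ _
      · rw [pd_pd, hS β (by simp [hβ, hβα])]
        simp

theorem expand_surjective (hs : AVIsSimple ρ) {lam : Fin m → ℂ} {v : ρ.M} (hv : v ≠ 0)
    (hvw : ∀ i, ρ.dd i v = lam i • v) : Function.Surjective (ρ.expand lam) := by
  rw [← LinearMap.range_eq_top, eq_top_iff, ← span_weights_eq_top hs hv hvw, Submodule.span_le]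
  rintro w ⟨r, hr⟩
  exact ρ.mem_range_expand Finset.univ w hr fun β hβ => absurd (Finset.mem_univ β) hβ

/-- Simultaneous eigenvectors with distinct systems of eigenvalues are independent. -/
theorem eq_zero_of_sum_eigenvectors {M X I : Type*} [AddCommGroup M] [Module ℂ M]
    (F : I → Module.End ℂ M) (c : X → I → ℂ) (hc : Function.Injective c) (v : X → M)
    (hv : ∀ x i, F i (v x) = c x i • v x) (s : Finset X) (a : X → ℂ)
    (h : ∑ x ∈ s, a x • v x = 0) : ∀ x ∈ s, a x • v x = 0 := by
  classical
  induction s using Finset.induction_on generalizing a with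
  | empty => simp
  | insert y s hy ih =>
    rw [Finset.sum_insert hy] at h
    have hs : ∀ x ∈ s, a x • v x = 0 := by
      intro x hx
      obtain ⟨i, hi⟩ : ∃ i, c x i ≠ c y i := by
        by_contra! hcon
        exact hy (hc (funext hcon) ▸ hx)
      have h1 : ∑ x ∈ s, ((c x i - c y i) * a x) • v x = 0 := by
        have h2 := congrArg (F i - c y i • (1 : Module.End ℂ M)) h
        simp only [map_add, map_sum, map_smul, LinearMap.sub_apply, hv, LinearMap.smul_apply,
          Module.End.one_apply, sub_self, smul_zero, zero_add, map_zero] at h2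
        rw [← h2]
        exact Finset.sum_congr rfl fun x _ => by module
      have h3 := ih _ h1 x hx
      rw [mul_smul] at h3
      exact (smul_eq_zero.mp h3).resolve_left (sub_ne_zero.mpr hi)
    intro x hx
    rcases Finset.mem_insert.mp hx with rfl | hx
    · rwa [Finset.sum_eq_zero hs, add_zero] at h
    · exact hs x hx

theorem AVRep.eq_zero_of_a_eq_zero {lam : Fin m → ℂ} {v : ρ.M} (hv : v ∈ ρ.lowest lam)
    (r : LExp m) (k : ℕ) (g : GExp n) (hk : gdeg g = k) (h : ρ.a (r, g) v = 0) : v = 0 := by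
  induction k generalizing g with
  | zero =>
    obtain rfl := gdeg_eq_zero.mp hk
    have h1 := congrArg (ρ.a (-r, gzero n)) h
    rw [a_a] at h1
    simpa [a_one] using h1
  | succ k ih =>
    obtain ⟨β, hβ⟩ : ∃ β, g β = true := by
      by_contra! hcon
      have : g = gzero n := by
        ext x; simpa [gzero] using hcon x
      rw [this, gdeg_gzero] at hk
      omega
    have h1 := congrArg (ρ.pd β) h
    rw [pd_a, hv.2 β] at h1
    simp only [map_zero, smul_zero, add_zero] at h1
    refine ih (derE β g) ?_ ((smul_eq_zero.mp h1).resolve_left (derC_ne_zero hβ))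
    have := gdeg_derE hβ
    omega

theorem expand_injective (ρ : AVRep m n false) (lam : Fin m → ℂ) :
    Function.Injective (ρ.expand lam) := by
  rw [← LinearMap.ker_eq_bot, LinearMap.ker_eq_bot']
  intro u hu
  let F : Fin m ⊕ Fin n → Module.End ℂ ρ.M :=
    Sum.elim ρ.dd fun α => ρ.a (0, gsingle α) * ρ.pd α
  let c : ABasis m n → Fin m ⊕ Fin n → ℂ := fun x =>
    Sum.elim (fun i => lam i + x.1 i) fun α => if x.2 α then 1 else 0
  have hc : Function.Injective c := by
    intro x y hxy
    refine Prod.ext (funext fun i => ?_) (funext fun α => ?_)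
    · simpa [c] using congrFun hxy (.inl i)
    · have := congrFun hxy (.inr α)
      simp only [c, Sum.elim_inr] at this
      cases hx : x.2 α <;> cases hy : y.2 α <;> simp_all
  have h1 := eq_zero_of_sum_eigenvectors F c hc (fun x => ρ.a x (u x)) ?_ u.support 1 ?_
  · ext x
    by_cases hx : x ∈ u.support
    · have h2 := h1 x hx
      rw [Pi.one_apply, one_smul] at h2
      exact ρ.eq_zero_of_a_eq_zero (u x).2 x.1 _ x.2 rfl h2
    · simp [Finsupp.notMem_support_iff.mp hx]
  · rintro ⟨r, g⟩ (i | α)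
    · simp only [F, c, Sum.elim_inl, ρ.dd_a, (u (r, g)).2.1 i, map_smul]
      module
    · simp only [F, c, Sum.elim_inr, Module.End.mul_apply, ρ.pd_a, (u (r, g)).2.2 α, map_zero,
        smul_zero, add_zero, map_smul, ρ.a_a]
      rcases Bool.eq_false_or_eq_true (g α) with hg | hg
      · rw [smul_smul, derC_mul_mulSgn hg, xorE_gsingle_derE hg]
        simp [hg]
      · simp [derC_of_false hg, hg]
  · simpa [AVRep.expand, Finsupp.lsum_apply, Finsupp.sum] using hu

end Operators

section Coordinates

variable {m n : ℕ} {ρ : AVRep m n false} {lam : Fin m → ℂ}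

/-- Coordinates of `M ≅ A ⊗ V'`. -/
def coord (hb : Function.Bijective (ρ.expand lam)) :
    ρ.M ≃ₗ[ℂ] (ABasis m n →₀ ρ.lowest lam) :=
  (LinearEquiv.ofBijective (ρ.expand lam) hb).symm

theorem hom_ext_of_expand (hb : Function.Bijective (ρ.expand lam)) {N : Type*} [AddCommGroup N] [Module ℂ N] {f g : ρ.M →ₗ[ℂ] N}
    (h : ∀ x (v : ρ.lowest lam), f (ρ.a x v) = g (ρ.a x v)) : f = g := by
  have : f ∘ₗ ρ.expand lam = g ∘ₗ ρ.expand lam := by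
    refine Finsupp.lhom_ext fun x v => ?_
    simpa using h x v
  refine LinearMap.ext fun w => ?_
  obtain ⟨u, rfl⟩ := hb.2 w
  exact LinearMap.congr_fun this u

variable (hb : Function.Bijective (ρ.expand lam))

@[simp] theorem coord_a (x : ABasis m n) (v : ρ.lowest lam) :
    coord hb (ρ.a x v) = Finsupp.single x v := by
  rw [coord, LinearEquiv.symm_apply_eq, LinearEquiv.ofBijective_apply, ρ.expand_single]

theorem coord_coe (v : ρ.lowest lam) : coord hb v = Finsupp.single (0, gzero n) v := by
  rw [← coord_a hb, ρ.a_one]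

/-- The coordinate functional at `x`. -/
def coordAt (x : ABasis m n) : ρ.M →ₗ[ℂ] ρ.lowest lam :=
  Finsupp.lapply x ∘ₗ (coord hb).toLinearMap

theorem coordAt_apply (x : ABasis m n) (w : ρ.M) : coordAt hb x w = coord hb w x := rfl

theorem coordAt_a (x y : ABasis m n) (v : ρ.lowest lam) :
    coordAt hb y (ρ.a x v) = if x = y then v else 0 := by
  rw [coordAt_apply, coord_a, Finsupp.single_apply]

theorem coordAt_coe (v : ρ.lowest lam) : coordAt hb (0, gzero n) v = v := by
  rw [coordAt_apply, coord_coe, Finsupp.single_eq_same]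

theorem ext_coordAt {v w : ρ.M} (h : ∀ x, coordAt hb x v = coordAt hb x w) : v = w :=
  (coord hb).injective (Finsupp.ext h)

theorem coordAt_dd (i : Fin m) (x : ABasis m n) (w : ρ.M) :
    coordAt hb x (ρ.dd i w) = (lam i + x.1 i) • coordAt hb x w := by
  refine LinearMap.congr_fun (f := coordAt hb x ∘ₗ ρ.dd i)
    (g := (lam i + x.1 i) • coordAt hb x) (hom_ext_of_expand hb ?_) w
  rintro ⟨p, q⟩ v
  simp only [LinearMap.comp_apply, LinearMap.smul_apply, ρ.dd_a, v.2.1 i, map_smul, map_add,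
    coordAt_a]
  split_ifs with h
  · subst h
    rw [← add_smul, add_comm]
  · simp

theorem coordAt_pd {β : Fin n} {g : GExp n} (hg : g β = true) (r : LExp m) (w : ρ.M) :
    coordAt hb (r, derE β g) (ρ.pd β w) = derC β g • coordAt hb (r, g) w := by
  refine LinearMap.congr_fun (f := coordAt hb (r, derE β g) ∘ₗ ρ.pd β)
    (g := derC β g • coordAt hb (r, g)) (hom_ext_of_expand hb ?_) w
  rintro ⟨p, q⟩ v
  simp only [LinearMap.comp_apply, LinearMap.smul_apply, ρ.pd_a, v.2.2 β, map_zero, smul_zero,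
    add_zero, map_smul, coordAt_a, Prod.mk.injEq]
  rcases Bool.eq_false_or_eq_true (q β) with hq | hq
  · by_cases hqg : q = g
    · simp [hqg]
    · have : derE β q ≠ derE β g := fun h => hqg (by
        rw [← xorE_gsingle_derE hq, h, xorE_gsingle_derE hg])
      simp [hqg, this]
  · have : q ≠ g := by rintro rfl; simp [hg] at hq
    simp [derC_of_false hq, this]

theorem coordAt_a_gzero (p r : LExp m) (g : GExp n) (w : ρ.M) :
    coordAt hb (r, g) (ρ.a (p, gzero n) w) = coordAt hb (r - p, g) w := by
  refine LinearMap.congr_fun (f := coordAt hb (r, g) ∘ₗ ρ.a (p, gzero n))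
    (g := coordAt hb (r - p, g)) (hom_ext_of_expand hb ?_) w
  rintro ⟨s, q⟩ v
  simp only [LinearMap.comp_apply, ρ.a_a, mulSgn_gzero_left, one_smul, gzero_xorE, coordAt_a,
    Prod.mk.injEq, eq_sub_iff_add_eq, add_comm]

theorem coordAt_gzero_a {q : GExp n} (hq : q ≠ gzero n) (p r : LExp m) (w : ρ.M) :
    coordAt hb (r, gzero n) (ρ.a (p, q) w) = 0 := by
  refine LinearMap.congr_fun (f := coordAt hb (r, gzero n) ∘ₗ ρ.a (p, q))
    (g := 0) (hom_ext_of_expand hb ?_) w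
  rintro ⟨s, g⟩ v
  simp only [LinearMap.comp_apply, ρ.a_a, map_smul, coordAt_a, Prod.mk.injEq, LinearMap.zero_apply]
  split_ifs with h
  · have hgq : ∀ x, q x = g x := by
      intro x
      have := congrFun h.2 x
      simpa [xorE] using this
    obtain ⟨x, hx⟩ : ∃ x, q x = true := by
      by_contra! hcon
      exact hq (funext fun x => by simpa using hcon x)
    rw [mulSgn_of_not_disjoint hx (hgq x ▸ hx), zero_smul]
  · exact smul_zero _

/-- The submodule `A ⊗ U` of `M`. -/
def tensorSub (U : Submodule ℂ (ρ.lowest lam)) : Submodule ℂ ρ.M :=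
  ⨅ x, U.comap (coordAt hb x)

theorem mem_tensorSub {U : Submodule ℂ (ρ.lowest lam)} {w : ρ.M} :
    w ∈ tensorSub hb U ↔ ∀ x, coordAt hb x w ∈ U := by
  simp [tensorSub]

theorem a_mem_tensorSub {U : Submodule ℂ (ρ.lowest lam)} (x : ABasis m n) {v : ρ.lowest lam}
    (hv : v ∈ U) : ρ.a x v ∈ tensorSub hb U := by
  rw [mem_tensorSub]
  intro y
  rw [coordAt_a]
  split_ifs
  exacts [hv, U.zero_mem]

theorem tensorSub_le {U : Submodule ℂ (ρ.lowest lam)} {N : Submodule ℂ ρ.M}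
    (h : ∀ x, ∀ v ∈ U, ρ.a x (v : ρ.M) ∈ N) : tensorSub hb U ≤ N := by
  intro w hw
  rw [mem_tensorSub] at hw
  have h1 : w = ρ.expand lam (coord hb w) :=
    ((LinearEquiv.ofBijective (ρ.expand lam) hb).apply_symm_apply w).symm
  rw [h1, AVRep.expand, Finsupp.lsum_apply]
  exact Submodule.sum_mem _ fun x _ => h x _ (hw x)

theorem a_mem_tensorSub_of_mem {U : Submodule ℂ (ρ.lowest lam)} (x : ABasis m n) {w : ρ.M}
    (hw : w ∈ tensorSub hb U) : ρ.a x w ∈ tensorSub hb U := by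
  refine tensorSub_le hb (N := (tensorSub hb U).comap (ρ.a x)) (fun y v hv => ?_) hw
  rw [Submodule.mem_comap, ρ.a_a]
  exact Submodule.smul_mem _ _ (a_mem_tensorSub hb _ hv)

/-- Membership in `A ⊗ U` is detected by odd derivatives and by the coordinates along Laurent
monomials. -/
theorem mem_tensorSub_of_pd {U : Submodule ℂ (ρ.lowest lam)} {w : ρ.M}
    (h : ∀ β, ρ.pd β w ∈ tensorSub hb U) (h0 : ∀ r, coordAt hb (r, gzero n) w ∈ U) :
    w ∈ tensorSub hb U := by
  rw [mem_tensorSub]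
  rintro ⟨r, g⟩
  by_cases hg : ∃ β, g β = true
  · obtain ⟨β, hβ⟩ := hg
    have h1 := (mem_tensorSub hb).mp (h β) (r, derE β g)
    rw [coordAt_pd hb hβ] at h1
    exact (U.smul_mem_iff (derC_ne_zero hβ)).mp h1
  · have : g = gzero n := funext fun x => by
      simpa using fun hx => hg ⟨x, hx⟩
    rw [this]
    exact h0 r

theorem coordAt_eq_zero_of_weight {s r : LExp m} {w : ρ.M}
    (hw : ∀ i, ρ.dd i w = (lam i + s i) • w) (hrs : r ≠ s) (g : GExp n) :
    coordAt hb (r, g) w = 0 := by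
  obtain ⟨i, hi⟩ := Function.ne_iff.mp hrs
  have h1 := coordAt_dd hb i (r, g) w
  rw [hw, map_smul, ← sub_eq_zero, ← sub_smul, add_sub_add_left_eq_sub] at h1
  refine (smul_eq_zero.mp h1).resolve_left (sub_ne_zero.mpr ?_)
  exact_mod_cast Ne.symm hi

theorem eq_of_pd_eq {s : LExp m} {v w : ρ.M} (hv : ∀ i, ρ.dd i v = (lam i + s i) • v)
    (hw : ∀ i, ρ.dd i w = (lam i + s i) • w) (h : ∀ β, ρ.pd β v = ρ.pd β w)
    (h0 : coordAt hb (s, gzero n) v = coordAt hb (s, gzero n) w) : v = w := by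
  have h1 : v - w ∈ tensorSub hb ⊥ := by
    refine mem_tensorSub_of_pd hb (fun β => ?_) fun r => ?_
    · rw [map_sub, h, sub_self]
      exact Submodule.zero_mem _
    · rw [map_sub, Submodule.mem_bot]
      by_cases hr : r = s
      · rw [hr, h0, sub_self]
      · rw [coordAt_eq_zero_of_weight hb hv hr, coordAt_eq_zero_of_weight hb hw hr, sub_self]
  refine sub_eq_zero.mp (ext_coordAt hb fun x => ?_)
  rw [map_zero]
  exact (Submodule.mem_bot ℂ).mp ((mem_tensorSub hb).mp h1 x)

/-- The coordinate along `t^s` of the action of `t^s ξ^q D` on lowest vectors. -/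
def coordFamily (s : LExp m) (q : GExp n) (D : Dir m n false) : Module.End ℂ (ρ.lowest lam) :=
  coordAt hb (s, gzero n) ∘ₗ ρ.w (s, q, D) ∘ₗ (ρ.lowest lam).subtype

theorem coordFamily_apply (s : LExp m) (q : GExp n) (D : Dir m n false) (v : ρ.lowest lam) :
    coordFamily hb s q D v = coordAt hb (s, gzero n) (ρ.w (s, q, D) v) := rfl

theorem dd_w_lowest (i : Fin m) (s : LExp m) (q : GExp n) (D : Dir m n false) (v : ρ.lowest lam) :
    ρ.dd i (ρ.w (s, q, D) v) = (lam i + s i) • ρ.w (s, q, D) v := by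
  rw [ρ.dd_w, v.2.1, map_smul, ← add_smul, add_comm]

theorem pd_w_lowest (β : Fin n) (s : LExp m) (q : GExp n) (D : Dir m n false)
    (v : ρ.lowest lam) :
    ρ.pd β (ρ.w (s, q, D) v) = derC β q • ρ.w (s, derE β q, D) v := by
  rw [ρ.pd_w, v.2.2, map_zero, smul_zero, add_zero]

theorem dd_a_lowest (i : Fin m) (s : LExp m) (q : GExp n) (v : ρ.lowest lam) :
    ρ.dd i (ρ.a (s, q) v) = (lam i + s i) • ρ.a (s, q) v := by
  rw [ρ.dd_a, v.2.1, map_smul, ← add_smul, add_comm]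

theorem pd_a_lowest (β : Fin n) (s : LExp m) (q : GExp n) (v : ρ.lowest lam) :
    ρ.pd β (ρ.a (s, q) v) = derC β q • ρ.a (s, derE β q) v := by
  rw [ρ.pd_a, v.2.2, map_zero, smul_zero, add_zero]

theorem w_mem_tensorSub {U : Submodule ℂ (ρ.lowest lam)}
    (hU : ∀ s q D, ∀ v ∈ U, coordFamily hb s q D v ∈ U) (s : LExp m) (D : Dir m n false)
    {v : ρ.lowest lam} (hv : v ∈ U) (k : ℕ) (q : GExp n) (hk : gdeg q = k) :
    ρ.w (s, q, D) v ∈ tensorSub hb U := by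
  induction k generalizing q with
  | zero =>
    obtain rfl := gdeg_eq_zero.mp hk
    refine mem_tensorSub_of_pd hb (fun β => ?_) fun r => ?_
    · rw [pd_w_lowest, derC_gzero, zero_smul]
      exact Submodule.zero_mem _
    · by_cases hr : r = s
      · subst hr
        exact hU r _ D v hv
      · rw [coordAt_eq_zero_of_weight hb (fun i => dd_w_lowest i s _ D v) hr]
        exact U.zero_mem
  | succ k ih =>
    refine mem_tensorSub_of_pd hb (fun β => ?_) fun r => ?_
    · rw [pd_w_lowest]
      rcases Bool.eq_false_or_eq_true (q β) with hq | hq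
      · refine Submodule.smul_mem _ _ (ih _ ?_)
        have := gdeg_derE hq
        omega
      · rw [derC_of_false hq, zero_smul]
        exact Submodule.zero_mem _
    · by_cases hr : r = s
      · subst hr
        exact hU r _ D v hv
      · rw [coordAt_eq_zero_of_weight hb (fun i => dd_w_lowest i s _ D v) hr]
        exact U.zero_mem

theorem w_mem_tensorSub_of_mem {U : Submodule ℂ (ρ.lowest lam)}
    (hU : ∀ s q D, ∀ v ∈ U, coordFamily hb s q D v ∈ U) (x : WBasis m n false) {w : ρ.M}
    (hw : w ∈ tensorSub hb U) : ρ.w x w ∈ tensorSub hb U := by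
  obtain ⟨s, q, D⟩ := x
  refine tensorSub_le hb (N := (tensorSub hb U).comap (ρ.w (s, q, D))) ?_ hw
  rintro ⟨r, g⟩ v hv
  rw [Submodule.mem_comap]
  have h1 := a_mem_tensorSub_of_mem hb (r, g) (w_mem_tensorSub hb hU s D hv _ q rfl)
  cases D with
  | di j =>
    rw [ρ.w_di_a]
    exact Submodule.add_mem _ (Submodule.smul_mem _ _ (a_mem_tensorSub hb _ hv))
      (Submodule.smul_mem _ _ h1)
  | pa β =>
    rw [ρ.w_pa_a]
    exact Submodule.add_mem _ (Submodule.smul_mem _ _ (a_mem_tensorSub hb _ hv))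
      (Submodule.smul_mem _ _ h1)

theorem eq_top_of_tensorSub_eq_top {U : Submodule ℂ (ρ.lowest lam)} (h : tensorSub hb U = ⊤) :
    U = ⊤ := by
  rw [eq_top_iff]
  intro v _
  have h1 : (v : ρ.M) ∈ tensorSub hb U := h ▸ Submodule.mem_top
  rw [← coordAt_coe hb v]
  exact (mem_tensorSub hb).mp h1 _

theorem eq_top_of_stable (hs : AVIsSimple ρ) {U : Submodule ℂ (ρ.lowest lam)} (hne : U ≠ ⊥)
    (hU : ∀ s q D, ∀ v ∈ U, coordFamily hb s q D v ∈ U) : U = ⊤ := by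
  refine eq_top_of_tensorSub_eq_top hb (hs.eq_top _ (fun x v hv => a_mem_tensorSub_of_mem hb x hv)
    (fun x v hv => w_mem_tensorSub_of_mem hb hU x hv) ?_)
  obtain ⟨v, hv, hv0⟩ := Submodule.exists_mem_ne_zero_of_ne_bot hne
  refine (Submodule.ne_bot_iff _).mpr ⟨v, ?_, by simpa using hv0⟩
  rw [← ρ.a_one v]
  exact a_mem_tensorSub hb _ hv

/-- A vector field `t^r d_i` maps lowest vectors to multiples of lowest vectors. -/
theorem w_gzero_lowest (r : LExp m) (D : Dir m n false) (v : ρ.lowest lam) :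
    ρ.w (r, gzero n, D) v = ρ.a (r, gzero n) (coordFamily hb r (gzero n) D v) := by
  refine eq_of_pd_eq hb (fun i => dd_w_lowest i r _ _ v) (fun i => dd_a_lowest i r _ _)
    (fun β => ?_) ?_
  · rw [pd_w_lowest, pd_a_lowest, derC_gzero, zero_smul, zero_smul]
  · rw [coordAt_a, if_pos rfl]
    rfl

theorem w_euler_lowest (α : Fin n) (v : ρ.lowest lam) :
    ρ.w (0, gsingle α, .pa α) v
      = (coordFamily hb 0 (gsingle α) (.pa α) v : ρ.lowest lam) := by
  refine eq_of_pd_eq hb (s := 0) (fun i => dd_w_lowest i 0 _ _ v)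
    (fun i => by rw [(coordFamily hb 0 (gsingle α) (.pa α) v).2.1]; simp)
    (fun β => ?_) ?_
  · rw [pd_w_lowest, (coordFamily hb 0 (gsingle α) (.pa α) v).2.2]
    by_cases hβ : β = α
    · subst hβ
      rw [derE_gsingle]
      exact (congrArg _ (v.2.2 β)).trans (smul_zero _)
    · rw [derC_gsingle_of_ne hβ, zero_smul]
  · rw [coordAt_coe]
    rfl

theorem coordAt_shifted (r s : LExp m) (g : GExp n) (i : Fin m) (w : ρ.M) :
    coordAt hb (s, g) (ρ.a (-r, gzero n) (ρ.w (r, gzero n, .di i) w))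
      = (s i : ℂ) • coordAt hb (s, g) w
        + coordFamily hb r (gzero n) (.di i) (coordAt hb (s, g) w) := by
  refine LinearMap.congr_fun
    (f := coordAt hb (s, g) ∘ₗ ρ.a (-r, gzero n) ∘ₗ ρ.w (r, gzero n, .di i))
    (g := (s i : ℂ) • coordAt hb (s, g)
      + coordFamily hb r (gzero n) (.di i) ∘ₗ coordAt hb (s, g)) (hom_ext_of_expand hb ?_) w
  rintro ⟨p, q⟩ v
  simp only [LinearMap.comp_apply, LinearMap.add_apply, LinearMap.smul_apply, ρ.w_di_a,
    w_gzero_lowest hb, map_add, map_smul, ρ.a_a, mulSgn_gzero_left, mulSgn_gzero_right, gzero_xorE,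
    xorE_gzero, gdeg_gzero, zero_mul, pow_zero, one_smul, mul_one, neg_add_cancel_left, coordAt_a,
    add_comm p r]
  split_ifs with h
  · obtain ⟨rfl, rfl⟩ := Prod.mk.injEq .. ▸ h
    rfl
  · simp

theorem coordAt_euler (α : Fin n) (s : LExp m) (w : ρ.M) :
    coordAt hb (s, gzero n) (ρ.w (0, gsingle α, .pa α) w)
      = coordFamily hb 0 (gsingle α) (.pa α) (coordAt hb (s, gzero n) w) := by
  refine LinearMap.congr_fun
    (f := coordAt hb (s, gzero n) ∘ₗ ρ.w (0, gsingle α, .pa α))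
    (g := coordFamily hb 0 (gsingle α) (.pa α) ∘ₗ coordAt hb (s, gzero n))
    (hom_ext_of_expand hb ?_) w
  rintro ⟨p, q⟩ v
  simp only [LinearMap.comp_apply, ρ.w_pa_a, w_euler_lowest hb, map_add, map_smul, coordAt_a,
    gdeg_gsingle]
  have h1 : (derC α q * mulSgn (gsingle α) (derE α q)) •
      (if ((0 + p : LExp m), xorE (gsingle α) (derE α q)) = (s, gzero n) then v else 0) = 0 := by
    rcases Bool.eq_false_or_eq_true (q α) with hq | hq
    · rw [xorE_gsingle_derE hq, if_neg, smul_zero]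
      intro h
      rw [(Prod.mk.inj h).2] at hq
      simp at hq
    · rw [derC_of_false hq, zero_mul, zero_smul]
  rw [h1, zero_add, pow_mul]
  split_ifs with h
  · norm_num
  · simp

/-- `ξ_α ∂_α ξ^q` is `ξ^q` or `0`. -/
theorem euler_smul {n : ℕ} {N : Type*} [AddCommGroup N] [Module ℂ N] {α : Fin n} {q : GExp n}
    (F : GExp n → N) :
    (derC α q * mulSgn (gsingle α) (derE α q)) • F (xorE (gsingle α) (derE α q))
      = (if q α then (1 : ℂ) else 0) • F q := by
  rcases Bool.eq_false_or_eq_true (q α) with hq | hq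
  · rw [derC_mul_mulSgn hq, xorE_gsingle_derE hq, hq]
    simp
  · rw [derC_of_false hq, hq]
    simp

theorem isCoordFamily (hs : AVIsSimple ρ) : IsCoordFamily lam (coordFamily hb) where
  di_di r s q i j := by
    refine LinearMap.ext fun v => ?_
    have h := coordAt_shifted hb r s (gzero n) i (ρ.w (s, q, .di j) v)
    rw [ρ.w_di_di, w_gzero_lowest hb, ρ.w_di_a] at h
    simp only [map_add, map_sub, map_smul, ρ.a_a, mulSgn_gzero_left, mulSgn_gzero_right,
      gzero_xorE, xorE_gzero, gdeg_gzero, zero_mul, mul_zero, pow_zero, one_smul, mul_one,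
      neg_add_cancel, coordAt_a_gzero, coordAt_a, ρ.a_one, sub_neg_eq_add, neg_add_cancel_comm_assoc,
      Prod.mk.injEq, true_and, add_comm r s, ← coordFamily_apply] at h
    simp only [LinearMap.sub_apply, Module.End.mul_apply, LinearMap.smul_apply]
    have h' : (if q = gzero n then coordFamily hb r (gzero n) (.di i) else 0) v
        = if q = gzero n then coordFamily hb r (gzero n) (.di i) v else 0 := by
      split_ifs <;> rfl
    rw [h']
    linear_combination (norm := module) -h
  di_pa r s q i β := by
    refine LinearMap.ext fun v => ?_
    have h := coordAt_shifted hb r s (gzero n) i (ρ.w (s, q, .pa β) v)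
    rw [ρ.w_di_pa, w_gzero_lowest hb, ρ.w_pa_a] at h
    simp only [map_add, map_smul, ρ.a_a, mulSgn_gzero_left, mulSgn_gzero_right,
      gzero_xorE, xorE_gzero, gdeg_gzero, zero_mul, mul_zero, pow_zero, one_smul, mul_one,
      neg_add_cancel, coordAt_a_gzero, ρ.a_one, sub_neg_eq_add, sub_zero, derC_gzero, zero_smul,
      zero_add, add_comm r s, ← coordFamily_apply] at h
    simp only [LinearMap.sub_apply, Module.End.mul_apply, LinearMap.smul_apply]
    linear_combination (norm := module) -h
  pa_di α s q j := by
    refine LinearMap.ext fun v => ?_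
    have h := coordAt_euler hb α s (ρ.w (s, q, .di j) v)
    rw [ρ.w_pa_di, w_euler_lowest hb] at h
    simp only [map_add, map_smul, zero_add, gdeg_gsingle, Pi.zero_apply, Int.cast_zero,
      mul_zero, zero_mul, zero_smul, sub_zero, one_add_one_eq_two, pow_mul, neg_one_sq, one_pow,
      one_smul] at h
    rw [euler_smul fun q' => coordAt hb (s, gzero n) (ρ.w (s, q', .di j) v)] at h
    simp only [← coordFamily_apply] at h
    simp only [LinearMap.sub_apply, Module.End.mul_apply, LinearMap.smul_apply]
    linear_combination (norm := module) -h
  pa_pa α s q β := by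
    refine LinearMap.ext fun v => ?_
    have h := coordAt_euler hb α s (ρ.w (s, q, .pa β) v)
    rw [ρ.w_pa_pa, w_euler_lowest hb] at h
    simp only [map_add, map_sub, map_smul, zero_add, gdeg_gsingle,
      one_add_one_eq_two, pow_mul, neg_one_sq, one_pow, one_mul, one_smul] at h
    rw [euler_smul fun q' => coordAt hb (s, gzero n) (ρ.w (s, q', .pa β) v)] at h
    have h' : (derC β (gsingle α) * mulSgn q (derE β (gsingle α))) •
        coordAt hb (s, gzero n) (ρ.w (s, xorE q (derE β (gsingle α)), .pa α) v)
        = (if β = α then (1 : ℂ) else 0) • coordAt hb (s, gzero n) (ρ.w (s, q, .pa β) v) := by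
      split_ifs with hβ
      · subst hβ
        rw [derE_gsingle, xorE_gzero, mulSgn_gzero_right, derC_gsingle_self, one_mul]
      · rw [derC_gsingle_of_ne hβ, zero_mul, zero_smul, zero_smul]
    rw [h'] at h
    simp only [← coordFamily_apply] at h
    simp only [LinearMap.sub_apply, Module.End.mul_apply, LinearMap.smul_apply]
    linear_combination (norm := module) -h
  di_zero i := by
    refine LinearMap.ext fun v => ?_
    have h : ρ.w (0, gzero n, .di i) v = lam i • (v : ρ.M) := v.2.1 i
    rw [coordFamily_apply, h, map_smul, coordAt_coe]
    rfl
  pa_zero β := by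
    refine LinearMap.ext fun v => ?_
    have h : ρ.w (0, gzero n, .pa β) v = 0 := v.2.2 β
    rw [coordFamily_apply, h, map_zero]
    rfl
  irred U hne hU := eq_top_of_stable hb hs hne hU

end Coordinates

section Lowest

variable {m n : ℕ} {ρ : AVRep m n false} {lam : Fin m → ℂ}

theorem finiteDimensional_lowest (hb : Function.Bijective (ρ.expand lam))
    (hfr : IsFiniteRank ρ) :
    FiniteDimensional ℂ (ρ.lowest lam) := by
  classical
  obtain ⟨S, hS⟩ := hfr
  let T : Finset (ρ.lowest lam) := S.biUnion fun s => (coord hb s).support.image (coord hb s)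
  have hT : Submodule.span ℂ (T : Set (ρ.lowest lam)) = ⊤ := by
    refine eq_top_of_tensorSub_eq_top hb ?_
    rw [eq_top_iff, ← hS, Submodule.span_le]
    rintro _ ⟨f, s, hs, rfl⟩
    refine a_mem_tensorSub_of_mem hb f ((mem_tensorSub hb).mpr fun x => ?_)
    by_cases hx : coord hb s x = 0
    · rw [coordAt_apply, hx]
      exact Submodule.zero_mem _
    · refine Submodule.subset_span (Finset.mem_coe.mpr (Finset.mem_biUnion.mpr
        ⟨s, hs, Finset.mem_image.mpr ⟨x, Finsupp.mem_support_iff.mpr hx, rfl⟩⟩))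
  exact ⟨⟨T, hT⟩⟩

end Lowest

section GlAction

variable {m n : ℕ} {ρ : AVRep m n false} {lam : Fin m → ℂ}

/-- The exponent of the even part of the variable with index `x`. -/
def gvarL : GlIdx m n → LExp m := Sum.elim (fun i => Pi.single i 1) 0

/-- The exponent of the odd part of the variable with index `x`. -/
def gvarG : GlIdx m n → GExp n := Sum.elim (fun _ => gzero n) gsingle

/-- The direction with index `y`. -/
def gdir : GlIdx m n → Dir m n false := Sum.elim .di .pa

/-- `1` for even indices, `0` for odd ones. -/
def geven : GlIdx m n → ℂ := Sum.elim 1 0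

/-- The weight `lam`, extended by zero to the odd directions. -/
def glam (lam : Fin m → ℂ) : GlIdx m n → ℂ := Sum.elim lam 0

/-- The action of `e_{xy}` on the lowest vectors. -/
def glAct (hb : Function.Bijective (ρ.expand lam)) (x y : GlIdx m n) :
    Module.End ℂ (ρ.lowest lam) :=
  coordFamily hb (gvarL x) (gvarG x) (gdir y) - (geven x * glam lam y) • 1

variable {hb : Function.Bijective (ρ.expand lam)}

theorem glAct_inr (α : Fin n) (y : GlIdx m n) :
    glAct hb (.inr α) y = coordFamily hb 0 (gsingle α) (gdir y) := by
  simp [glAct, gvarL, gvarG, geven]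

theorem derC_gsingle (a b : Fin n) : derC a (gsingle b) = if a = b then 1 else 0 := by
  split_ifs with h
  · rw [h, derC_gsingle_self]
  · exact derC_gsingle_of_ne h

theorem w_var_w_var (x y z w : GlIdx m n) (v : ρ.M) :
    ρ.w (gvarL x, gvarG x, gdir y) (ρ.w (gvarL z, gvarG z, gdir w) v)
      = (if y = z then (1 : ℂ) else 0) • ρ.w (gvarL x + gvarL z, gvarG x, gdir w) v
        - ((-1 : ℂ) ^ ((gpar x + gpar y) * (gpar z + gpar w)) * if w = x then 1 else 0) •
            ρ.w (gvarL x + gvarL z, gvarG z, gdir y) v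
        + (-1 : ℂ) ^ ((gpar x + gpar y) * (gpar z + gpar w)) •
            ρ.w (gvarL z, gvarG z, gdir w) (ρ.w (gvarL x, gvarG x, gdir y) v) := by
  rcases x with i | α <;> rcases y with j | β <;> rcases z with k | γ <;> rcases w with l | δ <;>
    [refine (ρ.w_di_di _ _ _ _ _ _ _).trans ?_; refine (ρ.w_di_pa _ _ _ _ _ _ _).trans ?_;
     refine (ρ.w_di_di _ _ _ _ _ _ _).trans ?_; refine (ρ.w_di_pa _ _ _ _ _ _ _).trans ?_;
     refine (ρ.w_pa_di _ _ _ _ _ _ _).trans ?_; refine (ρ.w_pa_pa _ _ _ _ _ _ _).trans ?_;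
     refine (ρ.w_pa_di _ _ _ _ _ _ _).trans ?_; refine (ρ.w_pa_pa _ _ _ _ _ _ _).trans ?_;
     refine (ρ.w_di_di _ _ _ _ _ _ _).trans ?_; refine (ρ.w_di_pa _ _ _ _ _ _ _).trans ?_;
     refine (ρ.w_di_di _ _ _ _ _ _ _).trans ?_; refine (ρ.w_di_pa _ _ _ _ _ _ _).trans ?_;
     refine (ρ.w_pa_di _ _ _ _ _ _ _).trans ?_; refine (ρ.w_pa_pa _ _ _ _ _ _ _).trans ?_;
     refine (ρ.w_pa_di _ _ _ _ _ _ _).trans ?_; refine (ρ.w_pa_pa _ _ _ _ _ _ _).trans ?_] <;>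
    simp [gvarL, gvarG, gdir, gpar, gdeg_gzero, gdeg_gsingle, derC_gsingle, Pi.single_apply] <;>
    split_ifs <;> subst_vars <;> simp [derE_gsingle, Even.neg_one_pow (by decide : Even 4)]

theorem w_var_a_var (x y z : GlIdx m n) (v : ρ.M) :
    ρ.w (gvarL x, gvarG x, gdir y) (ρ.a (gvarL z, gvarG z) v)
      = (if y = z then (1 : ℂ) else 0) • ρ.a (gvarL x + gvarL z, gvarG x) v
        + (-1 : ℂ) ^ ((gpar x + gpar y) * gpar z) •
            ρ.a (gvarL z, gvarG z) (ρ.w (gvarL x, gvarG x, gdir y) v) := by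
  rcases y with j | β <;>
    [refine (ρ.w_di_a _ _ _ _ _ _).trans ?_; refine (ρ.w_pa_a _ _ _ _ _ _).trans ?_] <;>
    rcases x with i | α <;> rcases z with k | γ <;>
    simp [gvarL, gvarG, gdir, gpar, gdeg_gzero, gdeg_gsingle, derC_gsingle, Pi.single_apply] <;>
    split_ifs <;> subst_vars <;> simp [derE_gsingle]

theorem w_var_a_gvarL (x y z : GlIdx m n) (v : ρ.M) :
    ρ.w (gvarL x, gvarG x, gdir y) (ρ.a (gvarL z, gzero n) v)
      = (geven z * if y = z then (1 : ℂ) else 0) • ρ.a (gvarL x + gvarL z, gvarG x) v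
        + ρ.a (gvarL z, gzero n) (ρ.w (gvarL x, gvarG x, gdir y) v) := by
  rcases y with j | β <;>
    [refine (ρ.w_di_a _ _ _ _ _ _).trans ?_; refine (ρ.w_pa_a _ _ _ _ _ _).trans ?_] <;>
    rcases x with i | α <;> rcases z with k | γ <;>
    simp [gvarL, gvarG, gdir, geven, gdeg_gzero, Pi.single_apply]

variable [FiniteDimensional ℂ (ρ.lowest lam)] [Nontrivial (ρ.lowest lam)]

theorem coordFamily_gzero (hZ : IsCoordFamily lam (coordFamily hb)) (s : LExp m)
    (y : GlIdx m n) : coordFamily hb s (gzero n) (gdir y)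
      = glam lam y • 1 + ∑ i, (s i : ℂ) • glAct hb (.inl i) y := by
  rcases y with j | β
  · simpa [glAct, gvarL, gvarG, geven, glam, gdir] using hZ.di_eq_affine s j
  · simpa [glAct, gvarL, gvarG, geven, glam, gdir] using hZ.pa_eq_linear s β

theorem coordFamily_gsingle (hZ : IsCoordFamily lam (coordFamily hb)) (s : LExp m) (α : Fin n)
    (y : GlIdx m n) : coordFamily hb s (gsingle α) (gdir y) = glAct hb (.inr α) y := by
  rw [glAct_inr, hZ.eq_const s _ _ (gdeg_gsingle α)]

/-- The action of `W(m,n)` on lowest vectors. -/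
theorem w_lowest (hZ : IsCoordFamily lam (coordFamily hb)) (s : LExp m) (f : GExp n)
    (y : GlIdx m n) (v : ρ.lowest lam) :
    ρ.w (s, f, gdir y) v
      = glam lam y • ρ.a (s, f) v
        + ∑ i, (s i : ℂ) • ρ.a (s, f) (glAct hb (.inl i) y v)
        + ∑ α, ((-1 : ℂ) ^ (gdeg f + 1) * derC α f) •
            ρ.a (s, derE α f) (glAct hb (.inr α) y v) := by
  induction hk : gdeg f using Nat.strong_induction_on generalizing f with
  | _ k ih =>
  subst hk
  refine eq_of_pd_eq hb (fun i => dd_w_lowest i s f _ v) (fun i => ?_) (fun β => ?_) ?_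
  · simp only [map_add, map_sum, map_smul, dd_a_lowest, smul_add, Finset.smul_sum]
    simp only [smul_comm (lam i + (s i : ℂ))]
  · simp only [map_add, map_sum, map_smul, pd_w_lowest, pd_a_lowest]
    have h3 : ∀ α, ((-1 : ℂ) ^ (gdeg f + 1) * derC α f) • derC β (derE α f) •
          ρ.a (s, derE β (derE α f)) (glAct hb (.inr α) y v)
        = derC β f • ((-1 : ℂ) ^ (gdeg (derE β f) + 1) * derC α (derE β f)) •
          ρ.a (s, derE α (derE β f)) (glAct hb (.inr α) y v) := by
      intro α
      rw [smul_smul, smul_smul, derE_comm β α, mul_assoc, derC_anticomm α β]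
      congr 1
      rcases Bool.eq_false_or_eq_true (f β) with hβ | hβ
      · rw [← gdeg_derE hβ]
        ring
      · simp [derC_of_false hβ]
    rw [Finset.sum_congr rfl fun α _ => h3 α]
    rcases Bool.eq_false_or_eq_true (f β) with hβ | hβ
    · rw [ih (gdeg (derE β f)) (by have := gdeg_derE hβ; omega) (derE β f) rfl]
      simp only [smul_add, Finset.smul_sum]
      simp only [smul_comm (derC β f)]
    · simp [derC_of_false hβ]
  · simp only [map_add, map_sum, map_smul, coordAt_a, ← coordFamily_apply]
    rcases Nat.lt_or_ge 1 (gdeg f) with h2 | h2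
    · have h0 : f ≠ gzero n := by
        rintro rfl
        simp [gdeg_gzero] at h2
      rw [hZ.eq_zero s f _ h2]
      have h3 : ∀ α, derC α f = 0 ∨ derE α f ≠ gzero n := by
        intro α
        rcases Bool.eq_false_or_eq_true (f α) with hα | hα
        · refine Or.inr fun h => ?_
          have := gdeg_derE hα
          rw [h, gdeg_gzero] at this
          omega
        · exact Or.inl (derC_of_false hα)
      simp only [Prod.mk.injEq, h0, and_false, if_false, smul_zero, Finset.sum_const_zero,
        add_zero, LinearMap.zero_apply, zero_add, true_and]
      refine (Finset.sum_eq_zero fun α _ => ?_).symm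
      rcases h3 α with h | h <;> simp [h]
    · rcases Nat.lt_or_ge (gdeg f) 1 with h1 | h1
      · obtain rfl := gdeg_eq_zero.mp (Nat.lt_one_iff.mp h1)
        rw [coordFamily_gzero hZ]
        simp
      · obtain ⟨α, rfl⟩ := gdeg_eq_one (le_antisymm h2 h1)
        have h0 : gsingle α ≠ gzero n := by
          intro h
          rw [h, gdeg_gzero] at h1
          omega
        rw [coordFamily_gsingle hZ, Finset.sum_eq_single α]
        · simp [h0, derE_gsingle, gdeg_gsingle]
        · intro β _ hβ
          simp [derC_gsingle_of_ne hβ]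
        · simp

theorem w_var_lowest (hZ : IsCoordFamily lam (coordFamily hb)) (x y : GlIdx m n)
    (v : ρ.lowest lam) :
    ρ.w (gvarL x, gvarG x, gdir y) v
      = glam lam y • ρ.a (gvarL x, gvarG x) v + ρ.a (gvarL x, gzero n) (glAct hb x y v) := by
  rw [w_lowest hZ]
  rcases x with i | α
  · simp [gvarL, gvarG, Pi.single_apply]
  · rw [Finset.sum_eq_single (s := Finset.univ) α]
    · simp [gvarL, gvarG, gdeg_gsingle, derE_gsingle]
    · intro β _ hβ
      simp [gvarG, derC_gsingle_of_ne hβ]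
    · simp

theorem coordFamily_var (hZ : IsCoordFamily lam (coordFamily hb)) (x z w : GlIdx m n) :
    coordFamily hb (gvarL x + gvarL z) (gvarG x) (gdir w)
      = (geven x * glam lam w) • 1 + glAct hb x w + (geven x * geven z) • glAct hb z w := by
  rcases x with i | α
  · have h := coordFamily_gzero hZ (gvarL (.inl i : GlIdx m n) + gvarL z) w
    refine h.trans ?_
    rcases z with k | γ <;>
      simp [gvarL, geven, add_smul, Finset.sum_add_distrib, Pi.single_apply, add_assoc]
  · refine (coordFamily_gsingle hZ _ α w).trans ?_
    simp [geven]

end GlAction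

section TensorIso

variable {m n : ℕ} {ρ : AVRep m n false} {lam : Fin m → ℂ}
  {hb : Function.Bijective (ρ.expand lam)}

theorem coordAt_gvar_a (p : LExp m) (x : GlIdx m n) (v : ρ.lowest lam) :
    coordAt hb (p, gzero n) (ρ.a (p, gvarG x) v) = geven x • v := by
  rw [coordAt_a]
  rcases x with i | α
  · simp [gvarG, geven]
  · have : gsingle α ≠ gzero n := fun h => by simpa [gsingle, gzero] using congrFun h α
    simp [gvarG, geven, this]

theorem coordAt_gvar_a_a (x z : GlIdx m n) (w : ρ.M) :
    coordAt hb (gvarL x + gvarL z, gzero n) (ρ.a (gvarL z, gvarG z) w)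
      = geven z • coordAt hb (gvarL x, gzero n) w := by
  rcases z with k | γ
  · simp [gvarG, geven, coordAt_a_gzero]
  · have : gsingle γ ≠ gzero n := fun h => by simpa [gsingle, gzero] using congrFun h γ
    simp [gvarG, geven, coordAt_gzero_a hb this]

theorem sign_mul_geven (x y z : GlIdx m n) :
    (-1 : ℂ) ^ ((gpar x + gpar y) * gpar z) * geven z = geven z := by
  rcases z with k | γ <;> simp [geven, gpar]

theorem sign_mul_geven_mul_glam (x y z w : GlIdx m n) :
    (-1 : ℂ) ^ ((gpar x + gpar y) * (gpar z + gpar w)) * (geven z * glam lam w)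
      = geven z * glam lam w := by
  rcases z with k | γ <;> rcases w with l | δ <;> simp [geven, gpar, glam]

variable [FiniteDimensional ℂ (ρ.lowest lam)] [Nontrivial (ρ.lowest lam)]

theorem coordAt_w_var (hZ : IsCoordFamily lam (coordFamily hb)) (x y : GlIdx m n)
    (v : ρ.lowest lam) :
    coordAt hb (gvarL x, gzero n) (ρ.w (gvarL x, gvarG x, gdir y) v)
      = (geven x * glam lam y) • v + glAct hb x y v := by
  rw [w_var_lowest hZ, map_add, map_smul, coordAt_gvar_a, coordAt_a, if_pos rfl, smul_smul,
    mul_comm]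

theorem coordAt_w_var_w_var (hZ : IsCoordFamily lam (coordFamily hb)) (x y z w : GlIdx m n)
    (v : ρ.lowest lam) :
    coordAt hb (gvarL x + gvarL z, gzero n)
        (ρ.w (gvarL x, gvarG x, gdir y) (ρ.w (gvarL z, gvarG z, gdir w) v))
      = glam lam w • ((geven x * if y = z then (1 : ℂ) else 0) • v
          + geven z • ((geven x * glam lam y) • v + glAct hb x y v))
        + ((geven x * geven z * if y = z then (1 : ℂ) else 0) • glAct hb z w v
          + ((geven x * glam lam y) • glAct hb z w v + glAct hb x y (glAct hb z w v))) := by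
  rw [w_var_lowest hZ z w, map_add, map_smul, w_var_a_var, w_var_a_gvarL]
  simp only [map_add, map_smul, coordAt_gvar_a, coordAt_gvar_a_a, coordAt_a_gzero,
    add_sub_cancel_right, coordAt_w_var hZ, smul_smul, sign_mul_geven]
  simp only [mul_comm, mul_left_comm]

theorem glAct_rel (hZ : IsCoordFamily lam (coordFamily hb)) (x y z w : GlIdx m n) :
    glAct hb x y * glAct hb z w
        - ((-1 : ℂ) ^ ((gpar x + gpar y) * (gpar z + gpar w))) • (glAct hb z w * glAct hb x y)
      = (if y = z then glAct hb x w else 0)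
        - ((-1 : ℂ) ^ ((gpar x + gpar y) * (gpar z + gpar w))) •
            (if w = x then glAct hb z y else 0) := by
  refine LinearMap.ext fun v => ?_
  have h := congrArg (coordAt hb (gvarL x + gvarL z, gzero n)) (w_var_w_var x y z w (v : ρ.M))
  have h1 := coordAt_w_var_w_var hZ z w x y v
  have h2 : coordAt hb (gvarL x + gvarL z, gzero n)
      (ρ.w (gvarL x + gvarL z, gvarG z, gdir y) v)
      = coordFamily hb (gvarL z + gvarL x) (gvarG z) (gdir y) v := by
    rw [add_comm (gvarL x), coordFamily_apply]
  rw [add_comm (gvarL z)] at h1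
  simp only [map_add, map_sub, map_smul, coordAt_w_var_w_var hZ x y z w, h1, h2,
    ← coordFamily_apply, coordFamily_var hZ, LinearMap.add_apply, LinearMap.smul_apply,
    Module.End.one_apply] at h
  have h3 : (if y = z then glAct hb x w else 0) = (if y = z then (1 : ℂ) else 0) • glAct hb x w := by
    split_ifs <;> simp
  have h4 : (if w = x then glAct hb z y else 0) = (if w = x then (1 : ℂ) else 0) • glAct hb z y := by
    split_ifs <;> simp
  rw [h3, h4]
  simp only [LinearMap.sub_apply, LinearMap.smul_apply, Module.End.mul_apply]
  have h5 := sign_mul_geven_mul_glam (lam := lam) x y z w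
  have h6 := sign_mul_geven_mul_glam (lam := lam) z w x y
  rw [mul_comm (gpar z + gpar w)] at h6
  generalize (-1 : ℂ) ^ ((gpar x + gpar y) * (gpar z + gpar w)) = ε at *
  have h5' := congrArg (fun c => c • (glAct hb x y v + (geven x * glam lam y) • v)) h5
  have h6' := congrArg (fun c => c • glAct hb z w v) h6
  linear_combination (norm := module) h + h5' + h6'

/-- The `gl(m,n)`-module of lowest vectors. -/
abbrev glRep (hZ : IsCoordFamily lam (coordFamily hb)) : GlRep m n where
  V := ρ.lowest lam
  ρ := glAct hb
  rel := glAct_rel hZ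

theorem glRep_isSimple (hs : AVIsSimple ρ) (hZ : IsCoordFamily lam (coordFamily hb)) :
    (glRep hZ).IsSimple := by
  refine ⟨exists_ne (0 : ρ.lowest lam), fun N hN => or_iff_not_imp_left.mpr fun hne =>
    eq_top_of_stable hb hs hne ?_⟩
  intro s q D v hv
  obtain ⟨y, rfl⟩ : ∃ y, gdir y = D := by
    rcases D with j | β
    exacts [⟨.inl j, rfl⟩, ⟨.inr β, rfl⟩]
  rcases Nat.lt_or_ge 1 (gdeg q) with h2 | h2
  · rw [hZ.eq_zero s q _ h2]
    exact N.zero_mem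
  rcases Nat.lt_or_ge (gdeg q) 1 with h1 | h1
  · obtain rfl := gdeg_eq_zero.mp (Nat.lt_one_iff.mp h1)
    rw [coordFamily_gzero hZ, LinearMap.add_apply, LinearMap.sum_apply]
    exact N.add_mem (N.smul_mem _ hv)
      (N.sum_mem fun i _ => N.smul_mem _ (hN (.inl i) y v hv))
  · obtain ⟨α, rfl⟩ := gdeg_eq_one (le_antisymm h2 h1)
    rw [coordFamily_gsingle hZ]
    exact hN (.inr α) y v hv

end TensorIso

section Intertwining

variable {m n : ℕ}

theorem tmA_single {σ : GlRep m n} (x y : ABasis m n) (v : σ.V) :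
    tmA x (Finsupp.single y v : TModule σ)
      = mulSgn x.2 y.2 • Finsupp.single (x.1 + y.1, xorE x.2 y.2) v :=
  Finsupp.sum_single_index (by simp)

theorem tmA_zero {σ : GlRep m n} (x : ABasis m n) : tmA x (0 : TModule σ) = 0 :=
  Finsupp.sum_zero_index

theorem tmA_add {σ : GlRep m n} (x : ABasis m n) (u u' : TModule σ) :
    tmA x (u + u') = tmA x u + tmA x u' :=
  Finsupp.sum_add_index' (by simp) (by simp)

theorem tmAct_di_single (σ : GlRep m n) (lam : Fin m → ℂ) (c : ℂ) (s : LExp m) (f : GExp n)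
    (j : Fin m) (r : LExp m) (g : GExp n) (v : σ.V) :
    tmAct σ lam c (s, f, (.di j : Dir m n false)) (Finsupp.single (r, g) v)
      = ((((r j : ℂ) + lam j) * mulSgn f g) • Finsupp.single (r + s, xorE f g) v)
        + (∑ i : Fin m, ((s i : ℂ) * mulSgn f g) •
            Finsupp.single (r + s, xorE f g) (σ.ρ (.inl i) (.inl j) v))
        + (∑ α : Fin n,
            ((-1 : ℂ) ^ gdeg g * ((-1 : ℂ) ^ (gdeg f + 1) * derC α f) * mulSgn (derE α f) g) •
              Finsupp.single (r + s, xorE (derE α f) g) (σ.ρ (.inr α) (.inl j) v)) := by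
  rw [tmAct, Finsupp.sum_single_index]
  simp

theorem tmAct_pa_single (σ : GlRep m n) (lam : Fin m → ℂ) (c : ℂ) (s : LExp m) (f : GExp n)
    (β : Fin n) (r : LExp m) (g : GExp n) (v : σ.V) :
    tmAct σ lam c (s, f, (.pa β : Dir m n false)) (Finsupp.single (r, g) v)
      = ((derC β g * mulSgn f (derE β g)) • Finsupp.single (r + s, xorE f (derE β g)) v)
        + (∑ i : Fin m, ((-1 : ℂ) ^ gdeg g * (s i : ℂ) * mulSgn f g) •
            Finsupp.single (r + s, xorE f g) (σ.ρ (.inl i) (.inr β) v))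
        + (∑ α : Fin n, (((-1 : ℂ) ^ (gdeg f + 1) * derC α f) * mulSgn (derE α f) g) •
            Finsupp.single (r + s, xorE (derE α f) g) (σ.ρ (.inr α) (.inr β) v)) := by
  rw [tmAct, Finsupp.sum_single_index]
  simp

theorem tmAct_zero (σ : GlRep m n) (lam : Fin m → ℂ) (c : ℂ) (x : WBasis m n false) :
    tmAct σ lam c x 0 = 0 := by
  rcases x with ⟨s, f, j | β⟩ <;> rw [tmAct, Finsupp.sum_zero_index]

theorem tmAct_add (σ : GlRep m n) (lam : Fin m → ℂ) (c : ℂ) (x : WBasis m n false)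
    (u u' : TModule σ) : tmAct σ lam c x (u + u') = tmAct σ lam c x u + tmAct σ lam c x u' := by
  rcases x with ⟨s, f, j | β⟩ <;> simp only [tmAct] <;>
    refine Finsupp.sum_add_index' (fun rc => ?_) fun rc v w => ?_
  · simp
  · simp only [map_add, Finsupp.single_add, smul_add, Finset.sum_add_distrib]
    abel
  · simp
  · simp only [map_add, Finsupp.single_add, smul_add, Finset.sum_add_distrib]
    abel

theorem sign_mul_mulSgn (f g : GExp n) :
    (-1 : ℂ) ^ (gdeg f * gdeg g) * mulSgn g f = mulSgn f g := by
  rw [mulSgn_comm f g]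

theorem sign_mul_derC_mul_mulSgn (α : Fin n) (f g : GExp n) :
    (-1 : ℂ) ^ (gdeg f * gdeg g) * (derC α f * mulSgn g (derE α f))
      = (-1) ^ gdeg g * derC α f * mulSgn (derE α f) g := by
  rcases Bool.eq_false_or_eq_true (f α) with hα | hα
  · rw [mulSgn_comm (derE α f) g, ← gdeg_derE hα, add_mul, pow_add, one_mul]
    ring
  · simp [derC_of_false hα]

variable {ρ : AVRep m n false} {lam : Fin m → ℂ} {hb : Function.Bijective (ρ.expand lam)}

theorem expand_coord (w : ρ.M) : ρ.expand lam (coord hb w) = w :=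
  (LinearEquiv.ofBijective (ρ.expand lam) hb).apply_symm_apply w

variable [FiniteDimensional ℂ (ρ.lowest lam)] [Nontrivial (ρ.lowest lam)]

theorem coord_a_eq_tmA (hZ : IsCoordFamily lam (coordFamily hb)) (x : ABasis m n) (w : ρ.M) :
    coord hb (ρ.a x w) = tmA (σ := glRep hZ) x (coord hb w) := by
  have key : ∀ u : TModule (glRep hZ),
      coord hb (ρ.a x (ρ.expand lam u)) = tmA (σ := glRep hZ) x u := by
    intro u
    induction u using Finsupp.induction_linear with
    | zero => rw [tmA_zero, map_zero, map_zero, map_zero]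
    | add u u' hu hu' => rw [tmA_add, map_add, map_add, map_add, hu, hu']
    | single y v =>
      rw [tmA_single, ρ.expand_single, ρ.a_a x.1 y.1 x.2 y.2, map_smul, coord_a]
  rw [← key, expand_coord]

theorem coord_w_a (hZ : IsCoordFamily lam (coordFamily hb)) (x : WBasis m n false)
    (y : ABasis m n) (v : ρ.lowest lam) :
    coord hb (ρ.w x (ρ.a y v)) = tmAct (glRep hZ) lam 0 x (Finsupp.single y v) := by
  obtain ⟨s, f, D⟩ := x
  obtain ⟨r, g⟩ := y
  rcases D with j | β
  · rw [tmAct_di_single, ρ.w_di_a]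
    have h := w_lowest hZ s f (.inl j) v
    simp only [gdir, glam, Sum.elim_inl] at h
    rw [h]
    simp only [map_add, map_sum, map_smul, ρ.a_a, coord_a, smul_add, Finset.smul_sum, smul_smul]
    have h1 (c : ℂ) : (-1) ^ (gdeg f * gdeg g) * (c * mulSgn g f) = c * mulSgn f g := by
      linear_combination c * sign_mul_mulSgn f g
    have h2 (α : Fin n) : (-1) ^ (gdeg f * gdeg g)
        * ((-1) ^ (gdeg f + 1) * derC α f * mulSgn g (derE α f))
        = (-1) ^ gdeg g * ((-1) ^ (gdeg f + 1) * derC α f) * mulSgn (derE α f) g := by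
      linear_combination (-1) ^ (gdeg f + 1) * sign_mul_derC_mul_mulSgn α f g
    simp only [h1, h2, add_comm s r, xorE_comm g, add_mul, add_smul]
    abel
  · rw [tmAct_pa_single, ρ.w_pa_a]
    have h := w_lowest hZ s f (.inr β) v
    simp only [gdir, glam, Sum.elim_inr, Pi.zero_apply, zero_smul, zero_add] at h
    rw [h]
    simp only [map_add, map_sum, map_smul, ρ.a_a, coord_a, smul_add, Finset.smul_sum, smul_smul]
    have h0 : (-1 : ℂ) ^ gdeg g * (-1) ^ gdeg g = 1 := by
      rw [← mul_pow]; norm_num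
    have h1 (c : ℂ) : (-1) ^ ((gdeg f + 1) * gdeg g) * (c * mulSgn g f)
        = (-1) ^ gdeg g * c * mulSgn f g := by
      rw [add_mul, one_mul, pow_add]
      linear_combination (-1) ^ gdeg g * c * sign_mul_mulSgn f g
    have h2 (α : Fin n) : (-1) ^ ((gdeg f + 1) * gdeg g)
        * ((-1) ^ (gdeg f + 1) * derC α f * mulSgn g (derE α f))
        = (-1) ^ (gdeg f + 1) * derC α f * mulSgn (derE α f) g := by
      rw [add_mul, one_mul, pow_add]
      linear_combination (-1) ^ gdeg g * (-1) ^ (gdeg f + 1) * sign_mul_derC_mul_mulSgn α f g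
        + (-1) ^ (gdeg f + 1) * derC α f * mulSgn (derE α f) g * h0
    simp only [h1, h2, add_comm s r, xorE_comm g, add_assoc]

theorem coord_w_eq_tmAct (hZ : IsCoordFamily lam (coordFamily hb)) (x : WBasis m n false)
    (w : ρ.M) : coord hb (ρ.w x w) = tmAct (glRep hZ) lam 0 x (coord hb w) := by
  have key : ∀ u : TModule (glRep hZ),
      coord hb (ρ.w x (ρ.expand lam u)) = tmAct (glRep hZ) lam 0 x u := by
    intro u
    induction u using Finsupp.induction_linear with
    | zero => rw [tmAct_zero, map_zero, map_zero, map_zero]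
    | add u u' hu hu' => rw [tmAct_add, map_add, map_add, map_add, hu, hu']
    | single y v => rw [ρ.expand_single, coord_w_a]
  rw [← key, expand_coord]

end Intertwining

end

end WSuper

namespace WSuper

/-- Let `V = W(m,n)` and `A = R_m ⊗ Λ`.  Every simple weight
`AV`-module of finite rank is a tensor module: it is isomorphic, compatibly
with both the `A`-action and the `W(m,n)`-action, to `A ⊗ V'` for a
finite-dimensional simple `gl(m,n)`-module `V'` and some `λ ∈ ℂ^m`, with the
`W(m,n)`-action given by the tensor module formulas `tmAct` and the `A`-action
by multiplication on the left tensor factor. -/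
theorem simple_weight_finiteRank_is_tensor (m n : ℕ) (ρ : AVRep m n false)
    (hw : IsWeightG ρ.g) (hfr : IsFiniteRank ρ) (hs : AVIsSimple ρ) :
    ∃ σ : GlRep m n, FiniteDimensional ℂ σ.V ∧ σ.IsSimple ∧
      ∃ (lam : Fin m → ℂ) (e : ρ.M ≃ₗ[ℂ] TModule σ),
        (∀ (x : WBasis m n false) (v : ρ.M),
            e (ρ.act (sng x) v) = tmAct σ lam 0 x (e v)) ∧
        (∀ (f : ABasis m n) (v : ρ.M),
            e (ρ.aact (asng f) v) = tmA f (e v)) := by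
  obtain ⟨lam, v, hv, hvw⟩ := exists_weight_vector hw hs.1
  have hb : Function.Bijective (ρ.expand lam) :=
    ⟨expand_injective ρ lam, expand_surjective hs hv hvw⟩
  have := finiteDimensional_lowest hb hfr
  have : Nontrivial (ρ.lowest lam) := by
    by_contra h
    have := not_nontrivial_iff_subsingleton.mp h
    exact hv ((coord hb).injective (Subsingleton.elim _ _))
  have hZ := isCoordFamily (hb := hb) hs
  exact ⟨glRep hZ, inferInstance, glRep_isSimple hs hZ, lam, coord hb,
    fun x u => coord_w_eq_tmAct hZ x u, fun f u => coord_a_eq_tmA hZ f u⟩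

end WSuper
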